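/- arXiv:2107.03076 — 6 statements merged into one kernel-verified Lean document; each statement's English description precedes it below -/
import Mathlib

section
/- Let E be a finite set, let 𝓛 be a laminar family of subsets of E, and let q : 𝓛 → ℕ. Then the family 𝓘 = {S ⊆ E : for every L ∈ 𝓛, |S ∩ L| ≤ q(L)} is the family of independent sets of a matroid on E; that is, 𝓘 contains the empty set, is closed under taking subsets, and satisfies the exchange property: for any S, T ∈ 𝓘 with |S| < |T| there exists e ∈ T \ S with S ∪ {e} ∈ 𝓘. -/
open Finset

/-- A family `𝓛` of (finite) subsets is *laminar* if any two members `L, L'` satisfy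
`L ⊆ L'`, `L ⊇ L'`, or `L ∩ L' = ∅`. -/
def Laminar {α : Type*} [DecidableEq α] (𝓛 : Finset (Finset α)) : Prop :=
  ∀ L ∈ 𝓛, ∀ L' ∈ 𝓛, L ⊆ L' ∨ L' ⊆ L ∨ L ∩ L' = ∅

/-- The family `𝓘 = {S : ∀ L ∈ 𝓛, |S ∩ L| ≤ q L}` determined by a family with quotas. -/
def LamIndep {α : Type*} [DecidableEq α] (𝓛 : Finset (Finset α)) (q : Finset α → ℕ)
    (S : Finset α) : Prop :=
  ∀ L ∈ 𝓛, (S ∩ L).card ≤ q L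

/-- `Indep` is the family of independent sets of a matroid: it contains the empty set,
is closed under taking subsets, and satisfies the exchange property. -/
def IsMatroid {α : Type*} [DecidableEq α] (Indep : Finset α → Prop) : Prop :=
  Indep ∅ ∧
  (∀ S T : Finset α, S ⊆ T → Indep T → Indep S) ∧
  (∀ S T : Finset α, Indep S → Indep T → S.card < T.card →
    ∃ e ∈ T \ S, Indep (insert e S))

/-- **Laminar matroid.** For a laminar family `𝓛` on a finite set `E` with quotas
`q : 𝓛 → ℕ`, the family `𝓘 = {S ⊆ E : ∀ L ∈ 𝓛, |S ∩ L| ≤ q L}` is the family of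
independent sets of a matroid on `E`. -/
theorem laminar_family_isMatroid {α : Type*} [DecidableEq α] [Fintype α]
    (𝓛 : Finset (Finset α)) (hlam : Laminar 𝓛) (q : Finset α → ℕ) :
    IsMatroid (LamIndep 𝓛 q) := by
  classical
  refine ⟨?_, ?_, ?_⟩
  · intro L _
    simp
  · intro S T hST hT L hL
    exact (card_le_card (inter_subset_inter_right hST)).trans (hT L hL)
  · intro S T hS hT hlt
    by_contra hcon
    have key : ∀ e ∈ T, e ∉ S → ∃ L ∈ 𝓛, e ∈ L ∧ (T ∩ L).card ≤ (S ∩ L).card := by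
      intro e heT heS
      by_contra hno
      refine hcon ⟨e, mem_sdiff.2 ⟨heT, heS⟩, ?_⟩
      intro L hL
      by_cases heL : e ∈ L
      · rw [insert_inter_of_mem heL]
        have h1 : ¬ (T ∩ L).card ≤ (S ∩ L).card := fun h => hno ⟨L, hL, heL, h⟩
        have h2 := card_insert_le e (S ∩ L)
        have h3 := hT L hL
        omega
      · rw [insert_inter_of_notMem heL]
        exact hS L hL
    set F := 𝓛.filter (fun L => (T ∩ L).card ≤ (S ∩ L).card) with hF
    set M := F.filter (fun L => Maximal (fun X => X ∈ F) L) with hM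
    have hdisj : ∀ L ∈ M, ∀ L' ∈ M, L ≠ L' → Disjoint L L' := by
      intro L hL L' hL' hne
      have a := (mem_filter.1 hL)
      have b := (mem_filter.1 hL')
      rcases hlam L (mem_filter.1 a.1).1 L' (mem_filter.1 b.1).1 with h | h | h
      · exact absurd (a.2.eq_of_le b.1 h) hne
      · exact absurd (b.2.eq_of_le a.1 h).symm hne
      · exact disjoint_iff_inter_eq_empty.2 h
    have hcard : ∀ X : Finset α, (X ∩ M.biUnion id).card = ∑ L ∈ M, (X ∩ L).card := by
      intro X
      rw [inter_biUnion, card_biUnion]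
      · rfl
      · intro L hL L' hL' hne
        exact (hdisj L hL L' hL' hne).mono inter_subset_right inter_subset_right
    have h1 : (T ∩ M.biUnion id).card ≤ (S ∩ M.biUnion id).card := by
      rw [hcard, hcard]
      exact sum_le_sum fun L hL => (mem_filter.1 (mem_filter.1 hL).1).2
    have h2 : T \ M.biUnion id ⊆ S \ M.biUnion id := by
      intro e he
      obtain ⟨heT, heU⟩ := mem_sdiff.1 he
      refine mem_sdiff.2 ⟨?_, heU⟩
      by_contra heS
      obtain ⟨L, hL, heL, hc⟩ := key e heT heS
      obtain ⟨K, hLK, hK⟩ := F.exists_le_maximal (mem_filter.2 ⟨hL, hc⟩ : L ∈ F)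
      exact heU (mem_biUnion.2 ⟨K, mem_filter.2 ⟨hK.1, hK⟩, hLK heL⟩)
    have h3 := card_le_card h2
    have h4 := card_inter_add_card_sdiff T (M.biUnion id)
    have h5 := card_inter_add_card_sdiff S (M.biUnion id)
    omega
end

section
/- Let (E, 𝓘₁) and (E, 𝓘₂) be matroids on the same finite ground set E, and suppose M, N ∈ 𝓘₁ ∩ 𝓘₂ with |M| < (1/2)|N|. Then there exists an element e ∈ N \ M such that M ∪ {e} ∈ 𝓘₁ ∩ 𝓘₂. -/
open Finset

/-- A *base* of the family `Indep` is an inclusion-wise maximal member of it. -/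
def IsBase {α : Type*} (Indep : Finset α → Prop) (B : Finset α) : Prop :=
  Indep B ∧ ∀ S : Finset α, Indep S → B ⊆ S → S = B

/-- A matroid (given by its independence family `Indep`) is *base-orderable* if for any
two bases `B₁, B₂` there is a bijection `φ : B₁ → B₂` such that for every `e ∈ B₁` both
`(B₁ \ {e}) ∪ {φ e}` and `(B₂ ∪ {e}) \ {φ e}` are bases. -/
def BaseOrderable {α : Type*} [DecidableEq α] (Indep : Finset α → Prop) : Prop :=
  ∀ B₁ B₂ : Finset α, IsBase Indep B₁ → IsBase Indep B₂ →
    ∃ φ : α → α, Set.BijOn φ (B₁ : Set α) (B₂ : Set α) ∧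
      ∀ e ∈ B₁, IsBase Indep (insert (φ e) (B₁.erase e)) ∧
        IsBase Indep ((insert e B₂).erase (φ e))

/-- If `M, N` are common independent sets of two matroids on the same ground set and
`|M| < (1/2)|N|`, then some `e ∈ N \ M` has `M + e` common independent. -/
theorem common_independent_augment {α : Type*} [DecidableEq α] [Fintype α]
    (Indep₁ Indep₂ : Finset α → Prop)
    (hmat₁ : IsMatroid Indep₁) (hmat₂ : IsMatroid Indep₂)
    (M N : Finset α) (hM₁ : Indep₁ M) (hM₂ : Indep₂ M)
    (hN₁ : Indep₁ N) (hN₂ : Indep₂ N)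
    (hcard : (M.card : ℚ) < 1 / 2 * N.card) :
    ∃ e ∈ N \ M, Indep₁ (insert e M) ∧ Indep₂ (insert e M) := by
  classical
  have key : ∀ I : Finset α → Prop, IsMatroid I → I M → I N →
      (N.filter (fun e => e ∈ M ∨ ¬ I (insert e M))).card ≤ M.card := by
    intro I hI hM hN
    by_contra! h
    obtain ⟨e, he, hi⟩ := hI.2.2 M _ hM (hI.2.1 _ N (Finset.filter_subset _ _) hN) h
    simp only [Finset.mem_sdiff, Finset.mem_filter] at he
    tauto
  by_contra! h
  have h1 := key Indep₁ hmat₁ hM₁ hN₁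
  have h2 := key Indep₂ hmat₂ hM₂ hN₂
  have hsub : N ⊆ N.filter (fun e => e ∈ M ∨ ¬ Indep₁ (insert e M)) ∪
      N.filter (fun e => e ∈ M ∨ ¬ Indep₂ (insert e M)) := by
    intro e he
    have := h e
    simp only [Finset.mem_sdiff, Finset.mem_union, Finset.mem_filter] at this ⊢
    tauto
  have h3 := (Finset.card_le_card hsub).trans (Finset.card_union_le _ _)
  have h4 : N.card ≤ 2 * M.card := by omega
  have h5 : (N.card : ℚ) ≤ 2 * M.card := by exact_mod_cast h4
  linarith
end

section
/- Let I be an SMTI-LC instance and let I* be its auxiliary instance with projection map π. For any stable matching M* of I*, the set M = π(M*) is a stable matching of I and satisfies |M| ≥ (2/3)|M_OPT|, where M_OPT is any maximum-cardinality stable matching of I. -/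
open Finset
open scoped Classical

noncomputable section

variable {W F E : Type*}

/-- Contract `e` is associated with agent `a` (i.e. `a` is its worker, resp. its firm). -/
def Assoc (wk : E → W) (fm : E → F) (a : W ⊕ F) (e : E) : Prop :=
  Sum.elim (fun w => wk e = w) (fun f => fm e = f) a

/-- The set `M_a = M ∩ E_a` of contracts of `M` associated with agent `a`. -/
def restrictTo (wk : E → W) (fm : E → F) (a : W ⊕ F) (M : Finset E) : Finset E :=
  M.filter (Assoc wk fm a)

/-- Each agent `a` has a laminar family `𝓛_a` of subsets of `E_a`: every member of
`lam a` consists of contracts associated with `a`, and any two members are nested or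
disjoint. -/
def LaminarOn (wk : E → W) (fm : E → F) (lam : W ⊕ F → Finset (Finset E)) : Prop :=
  ∀ a : W ⊕ F,
    (∀ L ∈ lam a, ∀ e ∈ L, Assoc wk fm a e) ∧
    (∀ L ∈ lam a, ∀ L' ∈ lam a, L ⊆ L' ∨ L' ⊆ L ∨ L ∩ L' = ∅)

/-- `M` is feasible for agent `a`: `|M_a ∩ L| ≤ q_a L` for every `L ∈ 𝓛_a`. -/
def FeasFor (wk : E → W) (fm : E → F) (lam : W ⊕ F → Finset (Finset E))
    (q : W ⊕ F → Finset E → ℕ) (a : W ⊕ F) (M : Finset E) : Prop :=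
  ∀ L ∈ lam a, (restrictTo wk fm a M ∩ L).card ≤ q a L

/-- Generic freeness for a contract type `C`: a contract `e ∉ M` is *free* for an
associated agent `a` if `M_a ∪ {e}` is feasible for `a`, or there is `e' ∈ M_a` with
`e ≻_a e'` such that `(M_a ∪ {e}) \ {e'}` is feasible for `a`.
(Here `feas a` takes the whole set and restricts to `a`'s contracts internally, and
`spref` is the strict preference relation.) -/
def FreeFor {C : Type*} [DecidableEq C] (wk : C → W) (fm : C → F)
    (feas : W ⊕ F → Finset C → Prop) (spref : W ⊕ F → C → C → Prop)
    (a : W ⊕ F) (M : Finset C) (e : C) : Prop :=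
  feas a (insert e M) ∨
    ∃ e' ∈ restrictTo wk fm a M, spref a e e' ∧ feas a ((insert e M).erase e')

/-- Generic stability: `M` is feasible for every agent, and no contract `e ∉ M` blocks
`M`, i.e. no `e ∉ M` is free for both its worker and its firm. -/
def IsStable {C : Type*} [DecidableEq C] (wk : C → W) (fm : C → F)
    (feas : W ⊕ F → Finset C → Prop) (spref : W ⊕ F → C → C → Prop)
    (M : Finset C) : Prop :=
  (∀ a : W ⊕ F, feas a M) ∧
    ∀ e ∉ M, ¬ (FreeFor wk fm feas spref (Sum.inl (wk e)) M e ∧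
        FreeFor wk fm feas spref (Sum.inr (fm e)) M e)

/-- Strict part `≻_a` of the total preorder `⪰_a`. -/
def SPref (pref : W ⊕ F → E → E → Prop) (a : W ⊕ F) (e e' : E) : Prop :=
  pref a e e' ∧ ¬ pref a e' e

/-- `e` and `e'` are tied in `⪰_a`. -/
def Tied (pref : W ⊕ F → E → E → Prop) (a : W ⊕ F) (e e' : E) : Prop :=
  pref a e e' ∧ pref a e' e

/-- Stability of `M` in the SMTI-LC instance `I`, whose preferences are the total
preorders `pref a = ⪰_a` (ties allowed). -/
def StableI [DecidableEq E] (wk : E → W) (fm : E → F)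
    (lam : W ⊕ F → Finset (Finset E)) (q : W ⊕ F → Finset E → ℕ)
    (pref : W ⊕ F → E → E → Prop) (M : Finset E) : Prop :=
  IsStable wk fm (FeasFor wk fm lam q) (SPref pref) M

/-! ### The auxiliary instance `I*`

Writing `E = {e_1, …, e_n}` (the indexing / fixed order within ties is given by a
`LinearOrder` on `E`), the auxiliary instance has contract set `E × Fin 3`, where
`(e, 0) = x_e`, `(e, 1) = y_e`, `(e, 2) = z_e` are the three copies of `e`, with the
same worker and firm as `e`. -/

/-- Section of a copy in an agent's auxiliary preference list: `0` for the main part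
(the `x`/`y`-copies of a worker's list, the `z`/`y`-copies of a firm's list), `1` for
the appended part (`z`-copies for workers, `x`-copies for firms). -/
def copySec (isWorker : Bool) (t : Fin 3) : ℕ :=
  if isWorker then (if t = 2 then 1 else 0) else (if t = 0 then 1 else 0)

/-- Position of a copy inside the block replacing a tie: in a worker's list each tie
`(e_{i₁} ⋯ e_{iℓ})` becomes `x_{i₁} ⋯ x_{iℓ} y_{i₁} ⋯ y_{iℓ}` (slot of `x` is `0`, of
`y` is `1`); in a firm's list it becomes `z_{i₁} ⋯ z_{iℓ} y_{i₁} ⋯ y_{iℓ}` (slot of `z`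
is `0`, of `y` is `1`). In the appended part all copies get slot `0`. -/
def copySlot (isWorker : Bool) (t : Fin 3) : ℕ :=
  if isWorker then (if t = 2 then 0 else (t : ℕ)) else (if t = 0 then 0 else 2 - (t : ℕ))

/-- The strict preference of agent `a` on the copies in the auxiliary instance `I*`:
compare lexicographically by section (main part before appended part), then by the
original preference `⪰_a` on the underlying contracts, then — within a tie of `⪰_a` —
by the slot of the copy, and finally by the fixed indexing order on `E` (the order in
which the contracts of a tie are listed). -/
def PrefStar [LinearOrder E] (pref : W ⊕ F → E → E → Prop) (a : W ⊕ F)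
    (c c' : E × Fin 3) : Prop :=
  copySec a.isLeft c.2 < copySec a.isLeft c'.2 ∨
    (copySec a.isLeft c.2 = copySec a.isLeft c'.2 ∧
      (SPref pref a c.1 c'.1 ∨
        (Tied pref a c.1 c'.1 ∧
          (copySlot a.isLeft c.2 < copySlot a.isLeft c'.2 ∨
            (copySlot a.isLeft c.2 = copySlot a.isLeft c'.2 ∧ c.1 < c'.1)))))

/-- Feasibility for agent `a` in the auxiliary instance `I*`, i.e. feasibility with
respect to the family `𝓛*_a`: for each contract `e ∈ E_a` the triple
`{x_e, y_e, z_e}` has quota `1`, and for each `L ∈ 𝓛_a` the lifted set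
`L* = {x_e, y_e, z_e : e ∈ L}` has quota `q_a L`. -/
def FeasForStar [DecidableEq E] (wk : E → W) (fm : E → F)
    (lam : W ⊕ F → Finset (Finset E)) (q : W ⊕ F → Finset E → ℕ)
    (a : W ⊕ F) (M : Finset (E × Fin 3)) : Prop :=
  (∀ e : E, Assoc wk fm a e →
      (restrictTo (fun c => wk c.1) (fun c => fm c.1) a M ∩
        ({e} ×ˢ (Finset.univ : Finset (Fin 3)))).card ≤ 1) ∧
  (∀ L ∈ lam a,
      (restrictTo (fun c => wk c.1) (fun c => fm c.1) a M ∩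
        (L ×ˢ (Finset.univ : Finset (Fin 3)))).card ≤ q a L)

/-- Stability of `M*` in the auxiliary instance `I*` (whose preferences `PrefStar` are
strict). -/
def StableStar [LinearOrder E] (wk : E → W) (fm : E → F)
    (lam : W ⊕ F → Finset (Finset E)) (q : W ⊕ F → Finset E → ℕ)
    (pref : W ⊕ F → E → E → Prop) (M : Finset (E × Fin 3)) : Prop :=
  IsStable (fun c => wk c.1) (fun c => fm c.1) (FeasForStar wk fm lam q)
    (PrefStar pref) M

/-- The projection `π : 2^{E*} → 2^E`, `π S* = {e : {x_e, y_e, z_e} ∩ S* ≠ ∅}`. -/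
def projAux [DecidableEq E] (S : Finset (E × Fin 3)) : Finset E := S.image Prod.fst

/-- Laminar greedy pairing of the elements of two finite sets `A`, `B`. -/
theorem lam_pairing {E : Type*} [DecidableEq E] (A B : Finset E) :
    ∀ (n : ℕ) (Fam : Finset (Finset E)), Fam.card = n →
    (∀ L ∈ Fam, ∀ L' ∈ Fam, L ⊆ L' ∨ L' ⊆ L ∨ Disjoint L L') →
    ∃ (D : Finset E) (g : E → E), D ⊆ B ∧ Set.InjOn g D ∧ (∀ b ∈ D, g b ∈ A) ∧
      (∀ b ∈ D, ∃ L ∈ Fam, b ∈ L ∧ g b ∈ L) ∧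
      (∀ L ∈ Fam, (∀ b ∈ B, b ∈ L → b ∈ D ∧ g b ∈ L) ∨
        (∀ m ∈ A, m ∈ L → ∃ b ∈ D, b ∈ L ∧ g b = m)) := by
  intro n
  induction n with
  | zero =>
    intro Fam hF _
    rw [Finset.card_eq_zero] at hF
    subst hF
    exact ⟨∅, id, by simp, by simp, by simp, by simp, by simp⟩
  | succ n ih =>
    intro Fam hF hl
    have hne : Fam.Nonempty := by
      rw [← Finset.card_pos]; omega
    obtain ⟨L, hL, hmax⟩ := Fam.exists_max_image Finset.card hne
    obtain ⟨D, g, hDB, hinj, hA, hpair, hone⟩ := ih (Fam.erase L)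
      (by rw [Finset.card_erase_of_mem hL]; omega)
      (fun L₁ h₁ L₂ h₂ => hl _ (Finset.mem_of_mem_erase h₁) _ (Finset.mem_of_mem_erase h₂))
    have hsub : ∀ L' ∈ Fam, L' ⊆ L ∨ Disjoint L' L := by
      intro L' hL'
      rcases hl _ hL' _ hL with h | h | h
      · exact Or.inl h
      · left
        rw [Finset.eq_of_subset_of_card_le h (hmax _ hL')]
      · exact Or.inr h
    have hcross : ∀ b ∈ D, (b ∈ L ↔ g b ∈ L) := by
      intro b hb
      obtain ⟨L', hL', h1, h2⟩ := hpair b hb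
      rcases hsub L' (Finset.mem_of_mem_erase hL') with h | h
      · exact ⟨fun _ => h h2, fun _ => h h1⟩
      · rw [Finset.disjoint_left] at h
        exact ⟨fun h' => absurd h' (h h1), fun h' => absurd h' (h h2)⟩
    -- unmatched elements inside `L`
    set UB := (B ∩ L) \ D with hUB
    set UA := (A ∩ L) \ D.image g with hUA
    -- a maximal new partial injection
    have hnew : ∃ (D' : Finset E) (h : E → E), D' ⊆ UB ∧ Set.InjOn h D' ∧
        (∀ b ∈ D', h b ∈ UA) ∧ (D' = UB ∨ D'.image h = UA) := by
      rcases le_total UB.card UA.card with hc | hc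
      · obtain ⟨T, hT, hTc⟩ := Finset.exists_subset_card_eq hc
        have e := Finset.equivOfCardEq hTc.symm
        refine ⟨UB, fun b => if hb : b ∈ UB then (e ⟨b, hb⟩ : E) else b, subset_rfl, ?_, ?_,
          Or.inl rfl⟩
        · intro x hx y hy hxy
          have hx' : x ∈ UB := hx
          have hy' : y ∈ UB := hy
          simp only [hx', hy', dif_pos] at hxy
          have := e.injective (Subtype.ext hxy)
          exact congrArg Subtype.val this
        · intro b hb
          simp only [hb, dif_pos]
          exact hT (e ⟨b, hb⟩).2
      · obtain ⟨T, hT, hTc⟩ := Finset.exists_subset_card_eq hc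
        have e := Finset.equivOfCardEq hTc
        refine ⟨T, fun b => if hb : b ∈ T then (e ⟨b, hb⟩ : E) else b, hT, ?_, ?_,
          Or.inr ?_⟩
        · intro x hx y hy hxy
          have hx' : x ∈ T := hx
          have hy' : y ∈ T := hy
          simp only [hx', hy', dif_pos] at hxy
          have := e.injective (Subtype.ext hxy)
          exact congrArg Subtype.val this
        · intro b hb
          simp only [hb, dif_pos]
          exact (e ⟨b, hb⟩).2
        · ext m
          simp only [Finset.mem_image]
          constructor
          · rintro ⟨b, hb, rfl⟩
            simp only [hb, dif_pos]
            exact (e ⟨b, hb⟩).2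
          · intro hm
            refine ⟨e.symm ⟨m, hm⟩, (e.symm ⟨m, hm⟩).2, ?_⟩
            simp
    obtain ⟨D', h, hD', hinj', hA', hmx⟩ := hnew
    have hdis : ∀ b ∈ D', b ∉ D := fun b hb => (Finset.mem_sdiff.1 (hD' hb)).2
    obtain ⟨G, hg1, hg2⟩ : ∃ G : E → E, (∀ b ∈ D, G b = g b) ∧ (∀ b ∈ D', G b = h b) :=
      ⟨fun b => if b ∈ D then g b else h b, fun b hb => if_pos hb,
        fun b hb => if_neg (hdis b hb)⟩
    have hBL : ∀ b ∈ D', b ∈ B ∧ b ∈ L := fun b hb =>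
      Finset.mem_inter.1 (Finset.mem_sdiff.1 (hD' hb)).1
    have hAL : ∀ b ∈ D', h b ∈ A ∧ h b ∈ L := fun b hb =>
      Finset.mem_inter.1 (Finset.mem_sdiff.1 (hA' b hb)).1
    have hAn : ∀ b ∈ D', ∀ b' ∈ D, g b' ≠ h b := fun b hb b' hb' heq =>
      (Finset.mem_sdiff.1 (hA' b hb)).2 (Finset.mem_image.2 ⟨b', hb', heq⟩)
    refine ⟨D ∪ D', G, ?_, ?_, ?_, ?_, ?_⟩
    · exact Finset.union_subset hDB (fun b hb => (hBL b hb).1)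
    · intro x hx y hy hxy
      simp only [Finset.coe_union, Set.mem_union, Finset.mem_coe] at hx hy
      rcases hx with hx | hx <;> rcases hy with hy | hy
      · rw [hg1 x hx, hg1 y hy] at hxy; exact hinj hx hy hxy
      · rw [hg1 x hx, hg2 y hy] at hxy; exact absurd hxy (hAn y hy x hx)
      · rw [hg2 x hx, hg1 y hy] at hxy; exact absurd hxy.symm (hAn x hx y hy)
      · rw [hg2 x hx, hg2 y hy] at hxy; exact hinj' hx hy hxy
    · intro b hb
      rcases Finset.mem_union.1 hb with hb | hb
      · rw [hg1 b hb]; exact hA b hb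
      · rw [hg2 b hb]; exact (hAL b hb).1
    · intro b hb
      rcases Finset.mem_union.1 hb with hb | hb
      · rw [hg1 b hb]
        obtain ⟨L', hL', h12⟩ := hpair b hb
        exact ⟨L', Finset.mem_of_mem_erase hL', h12⟩
      · rw [hg2 b hb]; exact ⟨L, hL, (hBL b hb).2, (hAL b hb).2⟩
    · intro L' hL'
      by_cases hLL : L' = L
      · subst hLL
        rcases hmx with hmx | hmx
        · left
          intro b hb hbL
          by_cases hbD : b ∈ D
          · rw [hg1 b hbD]
            exact ⟨Finset.mem_union_left _ hbD, (hcross b hbD).1 hbL⟩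
          · have : b ∈ D' := by
              rw [hmx, hUB]; simp [hb, hbL, hbD]
            rw [hg2 b this]
            exact ⟨Finset.mem_union_right _ this, (hAL b this).2⟩
        · right
          intro m hm hmL
          by_cases hmD : m ∈ D.image g
          · obtain ⟨b, hb, rfl⟩ := Finset.mem_image.1 hmD
            exact ⟨b, Finset.mem_union_left _ hb, (hcross b hb).2 hmL, hg1 b hb⟩
          · have : m ∈ D'.image h := by
              rw [hmx, hUA]; exact Finset.mem_sdiff.2 ⟨Finset.mem_inter.2 ⟨hm, hmL⟩, hmD⟩
            obtain ⟨b, hb, rfl⟩ := Finset.mem_image.1 this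
            exact ⟨b, Finset.mem_union_right _ hb, (hBL b hb).2, hg2 b hb⟩
      · rcases hone L' (Finset.mem_erase.2 ⟨hLL, hL'⟩) with h1 | h1
        · left
          intro b hb hbL
          obtain ⟨h2, h3⟩ := h1 b hb hbL
          rw [hg1 b h2]
          exact ⟨Finset.mem_union_left _ h2, h3⟩
        · right
          intro m hm hmL
          obtain ⟨b, hb, hbL, hbm⟩ := h1 m hm hmL
          exact ⟨b, Finset.mem_union_left _ hb, hbL, (hg1 b hb).trans hbm⟩

theorem feasFor_iff {W F E : Type*} [DecidableEq E] (wk : E → W) (fm : E → F)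
    (lam : W ⊕ F → Finset (Finset E)) (q : W ⊕ F → Finset E → ℕ)
    (hlam : LaminarOn wk fm lam) (a : W ⊕ F) (M : Finset E) :
    FeasFor wk fm lam q a M ↔ ∀ L ∈ lam a, (M ∩ L).card ≤ q a L := by
  unfold FeasFor
  refine forall₂_congr fun L hL => ?_
  have : restrictTo wk fm a M ∩ L = M ∩ L := by
    ext e
    simp only [restrictTo, Finset.mem_inter, Finset.mem_filter]
    exact ⟨fun h => ⟨h.1.1, h.2⟩, fun h => ⟨⟨h.1, (hlam a).1 L hL e h.2⟩, h.2⟩⟩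
  have h2 : (restrictTo wk fm a M ∩ L).card = (M ∩ L).card := by
    rw [← this]
  convert Iff.rfl using 2
  rw [← h2]
  congr!

theorem feasStar_of_feas {W F E : Type*} [LinearOrder E] (wk : E → W) (fm : E → F)
    (lam : W ⊕ F → Finset (Finset E)) (q : W ⊕ F → Finset E → ℕ)
    (hlam : LaminarOn wk fm lam) (a : W ⊕ F) (T : Finset (E × Fin 3)) (M : Finset E)
    (hinj : Set.InjOn Prod.fst (T : Set (E × Fin 3))) (hTM : ∀ c ∈ T, c.1 ∈ M)
    (hM : FeasFor wk fm lam q a M) : FeasForStar wk fm lam q a T := by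
  rw [feasFor_iff wk fm lam q hlam] at hM
  constructor
  · intro e _
    rw [Finset.card_le_one]
    intro x hx y hy
    simp only [restrictTo, Finset.mem_inter, Finset.mem_filter, Finset.mem_product,
      Finset.mem_singleton] at hx hy
    exact hinj hx.1.1 hy.1.1 (hx.2.1.trans hy.2.1.symm)
  · intro L hL
    refine le_trans ?_ (hM L hL)
    apply Finset.card_le_card_of_injOn Prod.fst
    · intro c hc
      simp only [restrictTo, Finset.coe_inter, Set.mem_inter_iff, Finset.mem_coe,
        Finset.mem_filter, Finset.mem_product] at hc
      simp only [Finset.coe_inter, Set.mem_inter_iff, Finset.mem_coe]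
      exact ⟨hTM c hc.1.1, hc.2.1⟩
    · intro x hx y hy
      simp only [restrictTo, Finset.coe_inter, Set.mem_inter_iff, Finset.mem_coe,
        Finset.mem_filter] at hx hy
      exact fun h => hinj hx.1.1 hy.1.1 h

theorem feas_of_feasStar {W F E : Type*} [LinearOrder E] (wk : E → W) (fm : E → F)
    (lam : W ⊕ F → Finset (Finset E)) (q : W ⊕ F → Finset E → ℕ)
    (hlam : LaminarOn wk fm lam) (a : W ⊕ F) (T : Finset (E × Fin 3))
    (hT : FeasForStar wk fm lam q a T) : FeasFor wk fm lam q a (projAux T) := by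
  rw [feasFor_iff wk fm lam q hlam]
  intro L hL
  refine le_trans ?_ (hT.2 L hL)
  refine le_trans (Finset.card_le_card ?_) (Finset.card_image_le (f := Prod.fst))
  intro e he
  simp only [projAux, Finset.mem_inter, Finset.mem_image] at he
  obtain ⟨⟨c, hc, rfl⟩, heL⟩ := he
  refine Finset.mem_image.2 ⟨c, ?_, rfl⟩
  simp only [restrictTo, Finset.mem_inter, Finset.mem_filter, Finset.mem_product,
    Finset.mem_univ, and_true]
  exact ⟨⟨hc, (hlam a).1 L hL _ heL⟩, heL⟩

theorem injOn_of_feasStar {W F E : Type*} [LinearOrder E] (wk : E → W) (fm : E → F)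
    (lam : W ⊕ F → Finset (Finset E)) (q : W ⊕ F → Finset E → ℕ) (T : Finset (E × Fin 3))
    (hT : ∀ a, FeasForStar wk fm lam q a T) :
    Set.InjOn Prod.fst (T : Set (E × Fin 3)) := by
  intro x hx y hy hxy
  have := (hT (Sum.inl (wk x.1))).1 x.1 rfl
  rw [Finset.card_le_one] at this
  apply this
  · simp only [restrictTo, Finset.mem_inter, Finset.mem_filter, Finset.mem_product,
      Finset.mem_singleton, Finset.mem_univ, and_true]
    exact ⟨hx, rfl⟩
  · simp only [restrictTo, Finset.mem_inter, Finset.mem_filter, Finset.mem_product,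
      Finset.mem_singleton, Finset.mem_univ, and_true]
    refine ⟨⟨hy, ?_⟩, hxy.symm⟩
    show wk y.1 = wk x.1
    rw [hxy]

/-- The exchange lemma for one side of the market. -/
theorem side_exchange {W F E : Type*} [Fintype E] [LinearOrder E] (wk : E → W) (fm : E → F)
    (lam : W ⊕ F → Finset (Finset E)) (q : W ⊕ F → Finset E → ℕ)
    (hlam : LaminarOn wk fm lam) (s : E → W ⊕ F)
    (hs : ∀ e e', Assoc wk fm (s e) e' → s e' = s e)
    (M N : Finset E) (hM : ∀ a, FeasFor wk fm lam q a M) (hN : ∀ a, FeasFor wk fm lam q a N) :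
    ∃ (D : Finset E) (g : E → E), D ⊆ N \ M ∧ Set.InjOn g D ∧ (∀ b ∈ D, g b ∈ M \ N) ∧
      (∀ b ∈ D, s (g b) = s b) ∧
      (∀ b ∈ D, FeasFor wk fm lam q (s b) ((insert b M).erase (g b))) ∧
      (∀ b ∈ D, FeasFor wk fm lam q (s b) ((insert (g b) N).erase b)) ∧
      (∀ b ∈ N \ M, b ∉ D → FeasFor wk fm lam q (s b) (insert b M)) := by
  simp only [feasFor_iff wk fm lam q hlam] at *
  obtain ⟨D, g, hD, hinj, hA, hpair, hone⟩ := lam_pairing (M \ N) (N \ M) _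
    ((Finset.univ : Finset E).biUnion fun e => lam (s e)) rfl (by
      intro L hL L' hL'
      simp only [Finset.mem_biUnion, Finset.mem_univ, true_and] at hL hL'
      obtain ⟨e, he⟩ := hL
      obtain ⟨e', he'⟩ := hL'
      by_cases hd : Disjoint L L'
      · exact Or.inr (Or.inr hd)
      · obtain ⟨x, hx, hx'⟩ := Finset.not_disjoint_iff.1 hd
        have h1 := hs e x ((hlam _).1 L he x hx)
        have h2 := hs e' x ((hlam _).1 L' he' x hx')
        rw [← h1] at he
        rw [← h2] at he'
        rcases (hlam _).2 L he L' he' with h | h | h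
        · exact Or.inl h
        · exact Or.inr (Or.inl h)
        · exact absurd h (Finset.Nonempty.ne_empty ⟨x, by simp [hx, hx']⟩))
  have hmemF : ∀ e, ∀ L ∈ lam (s e), L ∈ (Finset.univ : Finset E).biUnion fun e => lam (s e) :=
    fun e L hL => Finset.mem_biUnion.2 ⟨e, Finset.mem_univ _, hL⟩
  have hsame : ∀ b ∈ D, s (g b) = s b := by
    intro b hb
    obtain ⟨L, hL, h1, h2⟩ := hpair b hb
    simp only [Finset.mem_biUnion, Finset.mem_univ, true_and] at hL
    obtain ⟨e, he⟩ := hL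
    rw [hs e _ ((hlam _).1 L he _ h1), hs e _ ((hlam _).1 L he _ h2)]
  have hsplit : ∀ X Y L : Finset E, (X ∩ L).card = ((X \ Y) ∩ L).card + (X ∩ Y ∩ L).card := by
    intro X Y L
    rw [← Finset.card_union_of_disjoint]
    · congr 1
      ext x
      simp only [Finset.mem_inter, Finset.mem_union, Finset.mem_sdiff]
      tauto
    · rw [Finset.disjoint_left]
      intro x
      simp only [Finset.mem_inter, Finset.mem_sdiff]
      tauto
  have hlt : ∀ X Y L : Finset E, ((X \ Y) ∩ L).card < ((Y \ X) ∩ L).card →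
      (X ∩ L).card < (Y ∩ L).card := by
    intro X Y L h
    have h1 := hsplit X Y L
    have h2 := hsplit Y X L
    rw [Finset.inter_comm Y X] at h2
    omega
  -- if `b` is not matched inside `L` then `M` is not tight on `L`
  have hkey : ∀ b ∈ N \ M, ∀ L ∈ lam (s b), b ∈ L → ¬ (b ∈ D ∧ g b ∈ L) →
      (M ∩ L).card < (N ∩ L).card := by
    intro b hb L hL hbL hn
    rcases hone L (hmemF b L hL) with h | h
    · exact absurd (h b hb hbL) hn
    · apply hlt
      have h1 : ((M \ N) ∩ L) ⊆ (((N \ M) ∩ L).erase b).image g := by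
        intro m hm
        obtain ⟨hm1, hm2⟩ := Finset.mem_inter.1 hm
        obtain ⟨b', hb', hbL', rfl⟩ := h m hm1 hm2
        refine Finset.mem_image.2 ⟨b', ?_, rfl⟩
        refine Finset.mem_erase.2 ⟨?_, Finset.mem_inter.2 ⟨hD hb', hbL'⟩⟩
        rintro rfl
        exact hn ⟨hb', hm2⟩
      have h2 := (Finset.card_le_card h1).trans Finset.card_image_le
      have h3 := Finset.card_erase_lt_of_mem (Finset.mem_inter.2 ⟨hb, hbL⟩)
      omega
  have hkey2 : ∀ b ∈ D, ∀ L ∈ lam (s b), g b ∈ L → b ∉ L →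
      (N ∩ L).card < (M ∩ L).card := by
    intro b hb L hL hgL hbL
    rcases hone L (hmemF b L hL) with h | h
    · apply hlt
      have h1 : ((N \ M) ∩ L).image g ⊆ ((M \ N) ∩ L).erase (g b) := by
        intro m hm
        obtain ⟨b', hb', rfl⟩ := Finset.mem_image.1 hm
        obtain ⟨hb1, hb2⟩ := Finset.mem_inter.1 hb'
        obtain ⟨h3, h4⟩ := h b' hb1 hb2
        refine Finset.mem_erase.2 ⟨?_, Finset.mem_inter.2 ⟨hA b' h3, h4⟩⟩
        intro heq
        have := hinj h3 hb heq
        subst this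
        exact hbL hb2
      have h2 := Finset.card_le_card h1
      rw [Finset.card_image_of_injOn] at h2
      · have h3 := Finset.card_erase_lt_of_mem (Finset.mem_inter.2 ⟨hA b hb, hgL⟩)
        omega
      · intro x hx y hy hxy
        have hx' := Finset.mem_inter.1 (Finset.mem_coe.1 hx)
        have hy' := Finset.mem_inter.1 (Finset.mem_coe.1 hy)
        exact hinj (h x hx'.1 hx'.2).1 (h y hy'.1 hy'.2).1 hxy
    · obtain ⟨b', hb', hbL', heq⟩ := h (g b) (hA b hb) hgL
      have := hinj hb' hb heq
      subst this
      exact absurd hbL' hbL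
  have hins : ∀ (X L : Finset E) (e : E), ((insert e X) ∩ L).card ≤ (X ∩ L).card + 1 := by
    intro X L e
    refine le_trans (Finset.card_le_card ?_) (Finset.card_insert_le e (X ∩ L))
    intro x
    simp only [Finset.mem_inter, Finset.mem_insert]
    tauto
  have hins2 : ∀ (X L : Finset E) (e : E), e ∉ L → ((insert e X) ∩ L).card ≤ (X ∩ L).card := by
    intro X L e he
    refine Finset.card_le_card ?_
    intro x
    simp only [Finset.mem_inter, Finset.mem_insert]
    rintro ⟨rfl | h, h2⟩
    · exact absurd h2 he
    · exact ⟨h, h2⟩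
  have hers : ∀ (X L : Finset E) (e : E), ((X.erase e) ∩ L).card ≤ (X ∩ L).card := fun X L e =>
    Finset.card_le_card (Finset.inter_subset_inter_right (Finset.erase_subset _ _))
  have hexc : ∀ (X L : Finset E) (e m : E), m ∈ X → m ∈ L →
      (((insert e X).erase m) ∩ L).card ≤ (X ∩ L).card := by
    intro X L e m hm hmL
    have h1 : ((insert e X).erase m) ∩ L = ((insert e X) ∩ L).erase m := by
      ext x
      simp only [Finset.mem_inter, Finset.mem_erase]
      tauto
    rw [h1, Finset.card_erase_of_mem
      (Finset.mem_inter.2 ⟨Finset.mem_insert_of_mem hm, hmL⟩)]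
    have := hins X L e
    omega
  refine ⟨D, g, hD, hinj, hA, hsame, ?_, ?_, ?_⟩
  · intro b hb L hL
    by_cases hbL : b ∈ L
    · by_cases hgL : g b ∈ L
      · exact (hexc M L b (g b) (Finset.mem_sdiff.1 (hA b hb)).1 hgL).trans (hM _ L hL)
      · have h1 := hkey b (hD hb) L hL hbL (fun h => hgL h.2)
        have h2 := hers (insert b M) L (g b)
        have h3 := hins M L b
        have h4 := hN _ L hL
        omega
    · exact ((hers _ _ _).trans (hins2 M L b hbL)).trans (hM _ L hL)
  · intro b hb L hL
    by_cases hgL : g b ∈ L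
    · by_cases hbL : b ∈ L
      · exact (hexc N L (g b) b (Finset.mem_sdiff.1 (hD hb)).1 hbL).trans (hN _ L hL)
      · have h1 := hkey2 b hb L hL hgL hbL
        have h2 := hers (insert (g b) N) L b
        have h3 := hins N L (g b)
        have h4 := hM _ L hL
        omega
    · exact ((hers _ _ _).trans (hins2 N L (g b) hgL)).trans (hN _ L hL)
  · intro b hb hbD L hL
    by_cases hbL : b ∈ L
    · have h1 := hkey b hb L hL hbL (fun h => hbD h.1)
      have h3 := hins M L b
      have h4 := hN _ L hL
      omega
    · exact (hins2 M L b hbL).trans (hM _ L hL)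

/-- Free copies in the auxiliary instance: adding. -/
theorem star_add {W F E : Type*} [LinearOrder E] (wk : E → W) (fm : E → F)
    (lam : W ⊕ F → Finset (Finset E)) (q : W ⊕ F → Finset E → ℕ)
    (hlam : LaminarOn wk fm lam) (T : Finset (E × Fin 3))
    (hinj : Set.InjOn Prod.fst (T : Set (E × Fin 3))) (a : W ⊕ F) (b : E)
    (hb : b ∉ projAux T) (t : Fin 3)
    (h : FeasFor wk fm lam q a (insert b (projAux T))) :
    FeasForStar wk fm lam q a (insert (b, t) T) := by
  refine feasStar_of_feas wk fm lam q hlam a _ _ ?_ ?_ h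
  · rw [Finset.coe_insert]
    refine (Set.injOn_insert ?_).2 ⟨hinj, ?_⟩
    · intro hm
      exact hb (Finset.mem_image.2 ⟨_, hm, rfl⟩)
    · rintro ⟨c, hc, hcb⟩
      exact hb (Finset.mem_image.2 ⟨_, hc, hcb⟩)
  · intro c hc
    rcases Finset.mem_insert.1 hc with rfl | hc
    · exact Finset.mem_insert_self _ _
    · exact Finset.mem_insert_of_mem (Finset.mem_image.2 ⟨_, hc, rfl⟩)

/-- Free copies in the auxiliary instance: exchanging. -/
theorem star_swap {W F E : Type*} [LinearOrder E] (wk : E → W) (fm : E → F)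
    (lam : W ⊕ F → Finset (Finset E)) (q : W ⊕ F → Finset E → ℕ)
    (hlam : LaminarOn wk fm lam) (T : Finset (E × Fin 3))
    (hinj : Set.InjOn Prod.fst (T : Set (E × Fin 3))) (a : W ⊕ F) (b : E)
    (hb : b ∉ projAux T) (t : Fin 3) (m : E × Fin 3) (hm : m ∈ T)
    (h : FeasFor wk fm lam q a ((insert b (projAux T)).erase m.1)) :
    FeasForStar wk fm lam q a ((insert (b, t) T).erase m) := by
  have hI : Set.InjOn Prod.fst ((insert (b, t) T : Finset (E × Fin 3)) : Set (E × Fin 3)) := by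
    rw [Finset.coe_insert]
    refine (Set.injOn_insert ?_).2 ⟨hinj, ?_⟩
    · intro hm
      exact hb (Finset.mem_image.2 ⟨_, hm, rfl⟩)
    · rintro ⟨c, hc, hcb⟩
      exact hb (Finset.mem_image.2 ⟨_, hc, hcb⟩)
  refine feasStar_of_feas wk fm lam q hlam a _ _
    (hI.mono (Finset.coe_subset.2 (Finset.erase_subset _ _))) ?_ h
  intro c hc
  obtain ⟨hc1, hc2⟩ := Finset.mem_erase.1 hc
  refine Finset.mem_erase.2 ⟨?_, ?_⟩
  · intro heq
    exact hc1 (hI hc2 (Finset.mem_insert_of_mem hm) heq)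
  · rcases Finset.mem_insert.1 hc2 with rfl | hc
    · exact Finset.mem_insert_self _ _
    · exact Finset.mem_insert_of_mem (Finset.mem_image.2 ⟨_, hc, rfl⟩)

/-- A strictly preferred `y`-copy beats every copy. -/
theorem prefStar_y {W F E : Type*} [LinearOrder E] (pref : W ⊕ F → E → E → Prop)
    (a : W ⊕ F) (b : E) (m : E × Fin 3) (h : SPref pref a b m.1) :
    PrefStar pref a (b, 1) m := by
  obtain ⟨m, t⟩ := m
  rcases a with a | a <;> fin_cases t <;>
    simp_all [PrefStar, copySec]

/-- Worker side: if `x_b` does not beat `m`, then `m` is an `x`-copy or a `y`-copy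
strictly better than `b`. -/
theorem worker_case {W F E : Type*} [LinearOrder E] (pref : W ⊕ F → E → E → Prop)
    (htotal : ∀ (a : W ⊕ F) (e e' : E), pref a e e' ∨ pref a e' e)
    (w : W) (b : E) (m : E × Fin 3) (h : ¬ PrefStar pref (Sum.inl w) (b, 0) m) :
    m.2 = 0 ∨ (m.2 = 1 ∧ SPref pref (Sum.inl w) m.1 b) := by
  obtain ⟨m, t⟩ := m
  have htot := htotal (Sum.inl w) b m
  clear htotal
  fin_cases t <;>
    simp [PrefStar, copySec, copySlot, SPref, Tied] at h ⊢
  tauto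

/-- Firm side, symmetric. -/
theorem firm_case {W F E : Type*} [LinearOrder E] (pref : W ⊕ F → E → E → Prop)
    (htotal : ∀ (a : W ⊕ F) (e e' : E), pref a e e' ∨ pref a e' e)
    (f : F) (b : E) (m : E × Fin 3) (h : ¬ PrefStar pref (Sum.inr f) (b, 2) m) :
    m.2 = 2 ∨ (m.2 = 1 ∧ SPref pref (Sum.inr f) m.1 b) := by
  obtain ⟨m, t⟩ := m
  have htot := htotal (Sum.inr f) b m
  clear htotal
  fin_cases t <;>
    simp [PrefStar, copySec, copySlot, SPref, Tied] at h ⊢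
  tauto

/-- **Main theorem (Theorem 3.1).** For any SMTI-LC instance `I` (laminar constraints,
total preorder preferences) and any stable matching `M*` of its auxiliary instance
`I*`, the projection `M = π M*` is a stable matching of `I` and
`|M| ≥ (2/3)|M_OPT|`, where `M_OPT` is a maximum-cardinality stable matching of `I`. -/
theorem aux_projection_stable_and_approx {W F E : Type*} [Fintype E] [LinearOrder E]
    (wk : E → W) (fm : E → F)
    (lam : W ⊕ F → Finset (Finset E)) (q : W ⊕ F → Finset E → ℕ)
    (pref : W ⊕ F → E → E → Prop)
    (hlam : LaminarOn wk fm lam)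
    (htrans : ∀ a : W ⊕ F, Transitive (pref a))
    (htotal : ∀ (a : W ⊕ F) (e e' : E), pref a e e' ∨ pref a e' e)
    (Mstar : Finset (E × Fin 3))
    (hMstar : StableStar wk fm lam q pref Mstar)
    (MOPT : Finset E)
    (hopt : StableI wk fm lam q pref MOPT)
    (hmax : ∀ N : Finset E, StableI wk fm lam q pref N → N.card ≤ MOPT.card) :
    StableI wk fm lam q pref (projAux Mstar) ∧
      (2 / 3 : ℚ) * MOPT.card ≤ (projAux Mstar).card := by
  have hfeasS := hMstar.1
  have hinjS := injOn_of_feasStar wk fm lam q Mstar hfeasS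
  have hfeasM : ∀ a, FeasFor wk fm lam q a (projAux Mstar) := fun a =>
    feas_of_feasStar wk fm lam q hlam a Mstar (hfeasS a)
  have hcopy : ∀ e ∈ projAux Mstar, ∃ c ∈ Mstar, c.1 = e := fun e he => Finset.mem_image.1 he
  have hnotin : ∀ e ∉ projAux Mstar, ∀ t, (e, t) ∉ Mstar := fun e he t ht =>
    he (Finset.mem_image.2 ⟨_, ht, rfl⟩)
  -- lifting freeness
  have hlift : ∀ (a : W ⊕ F) (e : E), e ∉ projAux Mstar →
      FreeFor wk fm (FeasFor wk fm lam q) (SPref pref) a (projAux Mstar) e →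
      FreeFor (fun c : E × Fin 3 => wk c.1) (fun c => fm c.1) (FeasForStar wk fm lam q)
        (PrefStar pref) a Mstar (e, 1) := by
    intro a e he hfree
    rcases hfree with h | ⟨e', he', hp, hf⟩
    · exact Or.inl (star_add wk fm lam q hlam Mstar hinjS a e he 1 h)
    · right
      obtain ⟨he1, he2⟩ := Finset.mem_filter.1 he'
      obtain ⟨c, hc, rfl⟩ := hcopy e' he1
      exact ⟨c, Finset.mem_filter.2 ⟨hc, he2⟩, prefStar_y pref a e c hp,
        star_swap wk fm lam q hlam Mstar hinjS a e he 1 c hc hf⟩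
  have hstab : StableI wk fm lam q pref (projAux Mstar) := by
    refine ⟨hfeasM, ?_⟩
    rintro e he ⟨h1, h2⟩
    exact hMstar.2 (e, 1) (hnotin e he 1) ⟨hlift _ e he h1, hlift _ e he h2⟩
  refine ⟨hstab, ?_⟩
  set M := projAux Mstar with hMdef
  obtain ⟨DW, g, hDW, hgi, hgA, hgs, hg1, hg2, hg3⟩ := side_exchange wk fm lam q hlam
    (fun e => Sum.inl (wk e)) (fun e e' h => congrArg Sum.inl h) M MOPT hfeasM hopt.1
  obtain ⟨DF, k, hDF, hki, hkA, hks, hk1, hk2, hk3⟩ := side_exchange wk fm lam q hlam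
    (fun e => Sum.inr (fm e)) (fun e e' h => congrArg Sum.inr h) M MOPT hfeasM hopt.1
  simp only [Sum.inl.injEq, Sum.inr.injEq] at hgs hks
  -- nobody is unmatched on both sides
  have hcover : ∀ b ∈ MOPT \ M, b ∈ DW ∨ b ∈ DF := by
    intro b hb
    by_contra hn
    push Not at hn
    exact hstab.2 b (Finset.mem_sdiff.1 hb).2
      ⟨Or.inl (hg3 b hb hn.1), Or.inl (hk3 b hb hn.2)⟩
  -- no short augmenting path
  have hpath : ∀ b₁ ∈ DW, b₁ ∉ DF → ∀ b₂ ∈ DF, b₂ ∉ DW → g b₁ ≠ k b₂ := by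
    intro b₁ h1 h1' b₂ h2 h2' heq
    have hb1 := Finset.mem_sdiff.1 (hDW h1)
    have hb2 := Finset.mem_sdiff.1 (hDF h2)
    have hm := Finset.mem_sdiff.1 (hgA b₁ h1)
    obtain ⟨c, hc, hcm⟩ := hcopy _ hm.1
    have hW : ¬ PrefStar pref (Sum.inl (wk b₁)) (b₁, 0) c := by
      intro hp
      refine hMstar.2 (b₁, 0) (hnotin _ hb1.2 0) ⟨Or.inr ⟨c, ?_, hp, ?_⟩, Or.inl ?_⟩
      · refine Finset.mem_filter.2 ⟨hc, ?_⟩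
        show wk c.1 = wk b₁
        rw [hcm, hgs b₁ h1]
      · exact star_swap wk fm lam q hlam Mstar hinjS _ b₁ hb1.2 0 c hc (by
          rw [hcm]; exact hg1 b₁ h1)
      · exact star_add wk fm lam q hlam Mstar hinjS _ b₁ hb1.2 0 (hk3 b₁ (hDW h1) h1')
    have hF : ¬ PrefStar pref (Sum.inr (fm b₂)) (b₂, 2) c := by
      intro hp
      refine hMstar.2 (b₂, 2) (hnotin _ hb2.2 2) ⟨Or.inl ?_, Or.inr ⟨c, ?_, hp, ?_⟩⟩
      · exact star_add wk fm lam q hlam Mstar hinjS _ b₂ hb2.2 2 (hg3 b₂ (hDF h2) h2')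
      · refine Finset.mem_filter.2 ⟨hc, ?_⟩
        show fm c.1 = fm b₂
        rw [hcm, heq, hks b₂ h2]
      · exact star_swap wk fm lam q hlam Mstar hinjS _ b₂ hb2.2 2 c hc (by
          rw [hcm, heq]; exact hk1 b₂ h2)
    have hW' := worker_case pref htotal _ _ _ hW
    have hF' := firm_case pref htotal _ _ _ hF
    have hboth : SPref pref (Sum.inl (wk b₁)) c.1 b₁ ∧ SPref pref (Sum.inr (fm b₂)) c.1 b₂ := by
      rcases hW' with h | ⟨h, h'⟩ <;> rcases hF' with h3 | ⟨h3, h3'⟩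
      · rw [h] at h3; exact absurd h3 (by decide)
      · rw [h] at h3; exact absurd h3 (by decide)
      · rw [h] at h3; exact absurd h3 (by decide)
      · exact ⟨h', h3'⟩
    rw [hcm] at hboth
    refine hopt.2 (g b₁) hm.2 ⟨Or.inr ⟨b₁, ?_, ?_, ?_⟩, Or.inr ⟨b₂, ?_, ?_, ?_⟩⟩
    · exact Finset.mem_filter.2 ⟨hb1.1, (hgs b₁ h1).symm⟩
    · rw [hgs b₁ h1]; exact hboth.1
    · rw [hgs b₁ h1]; exact hg2 b₁ h1
    · refine Finset.mem_filter.2 ⟨hb2.1, ?_⟩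
      show fm b₂ = fm (g b₁)
      rw [heq, hks b₂ h2]
    · rw [heq, hks b₂ h2, ← heq]; exact hboth.2
    · rw [heq, hks b₂ h2]; exact hk2 b₂ h2
  -- counting
  have c1 : DW.card ≤ (M \ MOPT).card := Finset.card_le_card_of_injOn g hgA hgi
  have c2 : DF.card ≤ (M \ MOPT).card := Finset.card_le_card_of_injOn k hkA hki
  have c3 : (DW \ DF).card + (DF \ DW).card ≤ (M \ MOPT).card := by
    have e1 : ((DW \ DF).image g).card = (DW \ DF).card :=
      Finset.card_image_of_injOn (hgi.mono (Finset.coe_subset.2 Finset.sdiff_subset))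
    have e2 : ((DF \ DW).image k).card = (DF \ DW).card :=
      Finset.card_image_of_injOn (hki.mono (Finset.coe_subset.2 Finset.sdiff_subset))
    rw [← e1, ← e2, ← Finset.card_union_of_disjoint]
    · refine Finset.card_le_card (Finset.union_subset ?_ ?_)
      · intro m hm
        obtain ⟨b, hb, rfl⟩ := Finset.mem_image.1 hm
        exact hgA b (Finset.mem_sdiff.1 hb).1
      · intro m hm
        obtain ⟨b, hb, rfl⟩ := Finset.mem_image.1 hm
        exact hkA b (Finset.mem_sdiff.1 hb).1
    · rw [Finset.disjoint_left]
      intro m hm hm'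
      obtain ⟨b, hb, rfl⟩ := Finset.mem_image.1 hm
      obtain ⟨b', hb', heq⟩ := Finset.mem_image.1 hm'
      have hb := Finset.mem_sdiff.1 hb
      have hb' := Finset.mem_sdiff.1 hb'
      exact hpath b hb.1 hb.2 b' hb'.1 hb'.2 heq.symm
  have c4 : (MOPT \ M).card ≤ (DW ∪ DF).card := by
    refine Finset.card_le_card fun b hb => ?_
    exact Finset.mem_union.2 (hcover b hb)
  have c5 := Finset.card_union_add_card_inter DW DF
  have c6 := Finset.card_sdiff_add_card_inter DW DF
  have c7 := Finset.card_sdiff_add_card_inter DF DW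
  have c8 := Finset.card_sdiff_add_card_inter MOPT M
  have c9 := Finset.card_sdiff_add_card_inter M MOPT
  rw [Finset.inter_comm DF DW] at c7
  rw [Finset.inter_comm M MOPT] at c9
  have hfin : 2 * MOPT.card ≤ 3 * M.card := by omega
  have hq : (2 : ℚ) * MOPT.card ≤ 3 * M.card := by exact_mod_cast hfin
  linarith
end
end

section
/- Let I be an SMTI-LC instance and let I* be its auxiliary instance with projection map π. For any stable matching M* of I*, the set M = π(M*) is a stable matching of I. -/
open Finset
open scoped Classical

noncomputable section

variable {W F E : Type*}

theorem feas_iff_aux {W F E : Type*} [DecidableEq E] (wk : E → W) (fm : E → F)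
    (lam : W ⊕ F → Finset (Finset E)) (q : W ⊕ F → Finset E → ℕ) (a : W ⊕ F)
    (S : Finset (E × Fin 3)) (T : Finset E)
    (hT : ∀ e, e ∈ T ↔ ∃ t, (e, t) ∈ S)
    (hinj : ∀ c ∈ S, ∀ c' ∈ S, c.1 = c'.1 → c = c') :
    FeasForStar wk fm lam q a S ↔ FeasFor wk fm lam q a T := by
  have key : ∀ L : Finset E, (restrictTo wk fm a T ∩ L).card =
      (restrictTo (fun c => wk c.1) (fun c => fm c.1) a S ∩
        (L ×ˢ (Finset.univ : Finset (Fin 3)))).card := by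
    intro L
    symm
    refine Finset.card_bij (fun c _ => c.1) ?_ ?_ ?_
    · rintro ⟨e, t⟩ h
      simp only [restrictTo, Finset.mem_inter, Finset.mem_filter, Finset.mem_product,
        Finset.mem_univ, and_true] at h ⊢
      exact ⟨⟨(hT e).2 ⟨t, h.1.1⟩, h.1.2⟩, h.2⟩
    · intro c hc c' hc' h
      simp only [restrictTo, Finset.mem_inter, Finset.mem_filter] at hc hc'
      exact hinj c hc.1.1 c' hc'.1.1 h
    · intro e h
      simp only [restrictTo, Finset.mem_inter, Finset.mem_filter] at h
      obtain ⟨t, ht⟩ := (hT e).1 h.1.1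
      refine ⟨(e, t), ?_, rfl⟩
      simp only [restrictTo, Finset.mem_inter, Finset.mem_filter, Finset.mem_product,
        Finset.mem_univ, and_true]
      exact ⟨⟨ht, h.1.2⟩, h.2⟩
  constructor
  · intro h L hL
    have h2 := h.2 L hL
    rw [← key] at h2
    convert h2
  · intro h
    refine ⟨fun e _ => ?_, fun L hL => ?_⟩
    · refine Finset.card_le_one.2 ?_
      intro c hc c' hc'
      simp only [restrictTo, Finset.mem_inter, Finset.mem_filter, Finset.mem_product,
        Finset.mem_singleton] at hc hc'
      exact hinj c hc.1.1 c' hc'.1.1 (hc.2.1.trans hc'.2.1.symm)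
    · rw [← key]
      have h2 := h L hL
      convert h2

theorem free_lift_aux {W F E : Type*} [LinearOrder E] (wk : E → W) (fm : E → F)
    (lam : W ⊕ F → Finset (Finset E)) (q : W ⊕ F → Finset E → ℕ)
    (pref : W ⊕ F → E → E → Prop) (a : W ⊕ F)
    (S : Finset (E × Fin 3))
    (hinj : ∀ c ∈ S, ∀ c' ∈ S, c.1 = c'.1 → c = c')
    (e : E) (he : e ∉ projAux S)
    (h : FreeFor wk fm (FeasFor wk fm lam q) (SPref pref) a (projAux S) e) :
    FreeFor (fun c : E × Fin 3 => wk c.1) (fun c => fm c.1) (FeasForStar wk fm lam q)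
      (PrefStar pref) a S (e, 1) := by
  have hm : ∀ x, x ∈ projAux S ↔ ∃ t, (x, t) ∈ S := by
    intro x
    simp [projAux]
  have hne : ∀ c ∈ S, c.1 ≠ e := by
    rintro ⟨x, t⟩ hc rfl
    exact he ((hm x).2 ⟨t, hc⟩)
  have hinj' : ∀ c ∈ insert (e, (1 : Fin 3)) S, ∀ c' ∈ insert (e, (1 : Fin 3)) S,
      c.1 = c'.1 → c = c' := by
    intro c hc c' hc' hcc
    rcases Finset.mem_insert.1 hc with rfl | hc <;>
      rcases Finset.mem_insert.1 hc' with rfl | hc'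
    · rfl
    · exact absurd hcc.symm (hne _ hc')
    · exact absurd hcc (hne _ hc)
    · exact hinj c hc c' hc' hcc
  have hm' : ∀ x, x ∈ insert e (projAux S) ↔ ∃ t, (x, t) ∈ insert (e, (1 : Fin 3)) S := by
    intro x
    rw [Finset.mem_insert, hm]
    constructor
    · rintro (rfl | ⟨t, ht⟩)
      · exact ⟨1, Finset.mem_insert_self _ _⟩
      · exact ⟨t, Finset.mem_insert_of_mem ht⟩
    · rintro ⟨t, ht⟩
      rcases Finset.mem_insert.1 ht with h1 | h1
      · exact Or.inl (congrArg Prod.fst h1)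
      · exact Or.inr ⟨t, h1⟩
  rcases h with h | ⟨e', he', hp, hf⟩
  · exact Or.inl ((feas_iff_aux wk fm lam q a _ _ hm' hinj').2 h)
  · right
    simp only [restrictTo, Finset.mem_filter] at he'
    obtain ⟨t, ht⟩ := (hm e').1 he'.1
    refine ⟨(e', t), ?_, ?_, ?_⟩
    · simp only [restrictTo, Finset.mem_filter]
      exact ⟨ht, he'.2⟩
    · have hsec : copySec a.isLeft 1 < copySec a.isLeft t ∨
          copySec a.isLeft 1 = copySec a.isLeft t := by
        cases a.isLeft <;> fin_cases t <;> simp [copySec]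
      rcases hsec with h1 | h1
      · exact Or.inl h1
      · exact Or.inr ⟨h1, Or.inl hp⟩
    · refine (feas_iff_aux wk fm lam q a _ _ ?_ ?_).2 hf
      · intro x
        rw [Finset.mem_erase, hm']
        constructor
        · rintro ⟨hx, s, hs⟩
          exact ⟨s, Finset.mem_erase.2 ⟨fun h => hx (congrArg Prod.fst h), hs⟩⟩
        · rintro ⟨s, hs⟩
          obtain ⟨h1, h2⟩ := Finset.mem_erase.1 hs
          refine ⟨?_, s, h2⟩
          rintro rfl
          exact h1 (hinj' _ h2 _ (Finset.mem_insert_of_mem ht) rfl)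
      · intro c hc c' hc'
        exact hinj' c (Finset.mem_of_mem_erase hc) c' (Finset.mem_of_mem_erase hc')

/-- **Stability of the projection (Lemma 5.3).** For any SMTI-LC instance `I` (laminar
constraints, total preorder preferences) and any stable matching `M*` of its auxiliary
instance `I*`, the projection `M = π M*` is a stable matching of `I`. -/
theorem aux_projection_stable {W F E : Type*} [Fintype E] [LinearOrder E]
    (wk : E → W) (fm : E → F)
    (lam : W ⊕ F → Finset (Finset E)) (q : W ⊕ F → Finset E → ℕ)
    (pref : W ⊕ F → E → E → Prop)
    (hlam : LaminarOn wk fm lam)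
    (htrans : ∀ a : W ⊕ F, Transitive (pref a))
    (htotal : ∀ (a : W ⊕ F) (e e' : E), pref a e e' ∨ pref a e' e)
    (Mstar : Finset (E × Fin 3))
    (hMstar : StableStar wk fm lam q pref Mstar) :
    StableI wk fm lam q pref (projAux Mstar) := by
  obtain ⟨hfeas, hblock⟩ := hMstar
  have hinj : ∀ c ∈ Mstar, ∀ c' ∈ Mstar, c.1 = c'.1 → c = c' := by
    intro c hc c' hc' h
    have h1 := (hfeas (Sum.inl (wk c.1))).1 c.1 rfl
    refine Finset.card_le_one.1 h1 c ?_ c' ?_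
    · simp [restrictTo, Assoc, hc, Finset.mem_product]
    · simp [restrictTo, Assoc, hc', h, Finset.mem_product]
  refine ⟨fun a => ?_, fun e he hb => ?_⟩
  · exact (feas_iff_aux wk fm lam q a Mstar _ (by intro x; simp [projAux]) hinj).1 (hfeas a)
  · refine hblock (e, 1) ?_ ⟨?_, ?_⟩
    · intro h
      exact he (Finset.mem_image.2 ⟨_, h, rfl⟩)
    · exact free_lift_aux wk fm lam q pref _ Mstar hinj e he hb.1
    · exact free_lift_aux wk fm lam q pref _ Mstar hinj e he hb.2
end
end

section
/- Let I be an SMTI-LC instance and let I* be its auxiliary instance with projection map π. For any stable matching M* of I*, the set M = π(M*) satisfies |M| ≥ (2/3)|N| for every stable matching N of I; in particular |M| ≥ (2/3)|M_OPT| where M_OPT is a maximum-cardinality stable matching of I. -/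
open Finset
open scoped Classical

noncomputable section

variable {W F E : Type*}

lemma exists_pairing {E : Type*} (A B : Finset E) (LL : Finset (Finset E))
    (hl : ∀ L ∈ LL, ∀ L' ∈ LL, ∀ x ∈ L, x ∈ L' → L ⊆ L' ∨ L' ⊆ L) :
    ∃ P : Finset (E × E),
      (∀ p ∈ P, p.1 ∈ A ∧ p.2 ∈ B ∧ ∃ L ∈ LL, p.1 ∈ L ∧ p.2 ∈ L) ∧
      (∀ p ∈ P, ∀ p' ∈ P, p.1 = p'.1 → p = p') ∧
      (∀ p ∈ P, ∀ p' ∈ P, p.2 = p'.2 → p = p') ∧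
      ∀ L ∈ LL, (∀ e ∈ A, e ∈ L → ∃ b ∈ L, (e, b) ∈ P) ∨
        (∀ b ∈ B, b ∈ L → ∃ e ∈ L, (e, b) ∈ P) := by
  induction LL using Finset.induction_on_max_value (fun L : Finset E => L.card) with
  | empty => exact ⟨∅, by simp, by simp, by simp, by simp⟩
  | insert L0 s hL0 hmax ih =>
    obtain ⟨P0, h1, h2, h3, h4⟩ := ih (fun L hL L' hL' => hl L (mem_insert_of_mem hL) L'
      (mem_insert_of_mem hL'))
    let Q : Finset (E × E) → Prop := fun P =>
      (∀ p ∈ P, p.1 ∈ A ∧ p.2 ∈ B ∧ ∃ L ∈ insert L0 s, p.1 ∈ L ∧ p.2 ∈ L) ∧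
      (∀ p ∈ P, ∀ p' ∈ P, p.1 = p'.1 → p = p') ∧
      (∀ p ∈ P, ∀ p' ∈ P, p.2 = p'.2 → p = p') ∧
      ∀ L ∈ s, (∀ e ∈ A, e ∈ L → ∃ b ∈ L, (e, b) ∈ P) ∨
        (∀ b ∈ B, b ∈ L → ∃ e ∈ L, (e, b) ∈ P)
    have hQ0 : Q P0 := by
      refine ⟨fun p hp => ?_, h2, h3, h4⟩
      obtain ⟨ha, hb, L, hL, h⟩ := h1 p hp
      exact ⟨ha, hb, L, mem_insert_of_mem hL, h⟩
    have hsub : ∀ P, Q P → P ∈ (A ×ˢ B).powerset := by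
      intro P hP
      rw [mem_powerset]
      intro p hp
      rw [mem_product]
      exact ⟨(hP.1 p hp).1, (hP.1 p hp).2.1⟩
    obtain ⟨P, hP, hPmax⟩ := Finset.exists_max_image ((A ×ˢ B).powerset.filter Q) Finset.card
      ⟨P0, mem_filter.2 ⟨hsub _ hQ0, hQ0⟩⟩
    have hQ := (mem_filter.1 hP).2
    refine ⟨P, hQ.1, hQ.2.1, hQ.2.2.1, ?_⟩
    intro L hL
    rcases mem_insert.1 hL with rfl | hL
    swap
    · exact hQ.2.2.2 L hL
    by_contra hcon
    push Not at hcon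
    obtain ⟨⟨e, heA, heL, he⟩, ⟨b, hbB, hbL, hb⟩⟩ := hcon
    have key : ∀ L' ∈ insert L s, ∀ x ∈ L, x ∈ L' → L' ⊆ L := by
      intro L' hL' x hx hx'
      rcases hl L hL L' hL' x hx hx' with h | h
      · rcases mem_insert.1 hL' with rfl | h'
        · exact h
        · exact (Finset.eq_of_subset_of_card_le h (hmax L' h')).symm.subset
      · exact h
    have hne : ∀ p ∈ P, p.1 ≠ e := by
      rintro ⟨p1, p2⟩ hp rfl
      obtain ⟨_, _, L', hL', h1', h2'⟩ := hQ.1 _ hp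
      exact he p2 (key L' hL' _ heL h1' h2') hp
    have hnb : ∀ p ∈ P, p.2 ≠ b := by
      rintro ⟨p1, p2⟩ hp rfl
      obtain ⟨_, _, L', hL', h1', h2'⟩ := hQ.1 _ hp
      exact hb p1 (key L' hL' _ hbL h2' h1') hp
    have hnew : Q (insert (e, b) P) := by
      refine ⟨?_, ?_, ?_, ?_⟩
      · intro p hp
        rcases mem_insert.1 hp with rfl | hp
        · exact ⟨heA, hbB, L, mem_insert_self _ _, heL, hbL⟩
        · exact hQ.1 p hp
      · intro p hp p' hp' h
        rcases mem_insert.1 hp with rfl | hp <;> rcases mem_insert.1 hp' with rfl | hp'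
        · rfl
        · exact absurd h.symm (hne p' hp')
        · exact absurd h (hne p hp)
        · exact hQ.2.1 p hp p' hp' h
      · intro p hp p' hp' h
        rcases mem_insert.1 hp with rfl | hp <;> rcases mem_insert.1 hp' with rfl | hp'
        · rfl
        · exact absurd h.symm (hnb p' hp')
        · exact absurd h (hnb p hp)
        · exact hQ.2.2.1 p hp p' hp' h
      · intro L' hL'
        rcases hQ.2.2.2 L' hL' with h | h
        · left
          intro x hx hx'
          obtain ⟨y, hy, hy'⟩ := h x hx hx'
          exact ⟨y, hy, mem_insert_of_mem hy'⟩
        · right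
          intro x hx hx'
          obtain ⟨y, hy, hy'⟩ := h x hx hx'
          exact ⟨y, hy, mem_insert_of_mem hy'⟩
    have hnot : (e, b) ∉ P := fun h => hne _ h rfl
    have := hPmax _ (mem_filter.2 ⟨hsub _ hnew, hnew⟩)
    rw [card_insert_of_notMem hnot] at this
    omega

lemma feas_iff {W F E : Type*} (wk : E → W) (fm : E → F) (lam : W ⊕ F → Finset (Finset E))
    (q : W ⊕ F → Finset E → ℕ) (hlam : LaminarOn wk fm lam) (a : W ⊕ F) (M : Finset E) :
    FeasFor wk fm lam q a M ↔
      ∀ L ∈ lam a, ∀ S : Finset E, (∀ x, x ∈ S ↔ x ∈ M ∧ x ∈ L) → S.card ≤ q a L := by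
  have key : ∀ L ∈ lam a, ∀ S : Finset E, (∀ x, x ∈ S ↔ x ∈ M ∧ x ∈ L) →
      S = restrictTo wk fm a M ∩ L := by
    intro L hL S hS
    ext x
    rw [hS, mem_inter, restrictTo, mem_filter]
    have := (hlam a).1 L hL x
    tauto
  constructor
  · intro h L hL S hS
    rw [key L hL S hS]
    exact h L hL
  · intro h L hL
    apply h L hL
    intro x
    rw [mem_inter, restrictTo, mem_filter]
    have := (hlam a).1 L hL x
    tauto

/-- one-sided consequences of a pairing -/
lemma exchange_aux {E : Type*} [DecidableEq E] (M N A B L : Finset E) (P : Finset (E × E))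
    (hP : ∀ p ∈ P, p.1 ∈ A ∧ p.2 ∈ B)
    (hP1 : ∀ p ∈ P, ∀ p' ∈ P, p.1 = p'.1 → p = p')
    (hA : ∀ x ∈ L, x ∈ A ↔ x ∈ N ∧ x ∉ M)
    (hB : ∀ x ∈ L, x ∈ B ↔ x ∈ M ∧ x ∉ N)
    (hL : (∀ e ∈ A, e ∈ L → ∃ b ∈ L, (e, b) ∈ P) ∨ (∀ b ∈ B, b ∈ L → ∃ e ∈ L, (e, b) ∈ P))
    (e : E) (heA : e ∈ A) (heL : e ∈ L) (hne : ∀ b ∈ L, (e, b) ∉ P) :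
    (M ∩ L).card + 1 ≤ (N ∩ L).card := by
  have hL' : ∀ b ∈ B, b ∈ L → ∃ e ∈ L, (e, b) ∈ P := by
    rcases hL with h | h
    · obtain ⟨b, hb, hb'⟩ := h e heA heL
      exact absurd hb' (hne b hb)
    · exact h
  have hcard : ((M ∩ L) \ N).card ≤ (((N ∩ L) \ M).erase e).card := by
    have : ∀ b : E, ∃ e' : E, b ∈ (M ∩ L) \ N → e' ∈ L ∧ (e', b) ∈ P := by
      intro b
      by_cases hb : b ∈ (M ∩ L) \ N
      · rw [mem_sdiff, mem_inter] at hb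
        obtain ⟨e', h1, h2⟩ := hL' b ((hB b hb.1.2).2 ⟨hb.1.1, hb.2⟩) hb.1.2
        exact ⟨e', fun _ => ⟨h1, h2⟩⟩
      · exact ⟨b, fun h => absurd h hb⟩
    choose g hg using this
    apply Finset.card_le_card_of_injOn g
    · intro b hb
      obtain ⟨h1, h2⟩ := hg b hb
      have hb2 : b ∈ L := by
        have hb' : b ∈ (M ∩ L) \ N := hb
        rw [mem_sdiff, mem_inter] at hb'
        exact hb'.1.2
      have h3 := (hA _ h1).1 (hP _ h2).1
      rw [mem_coe, mem_erase, mem_sdiff, mem_inter]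
      refine ⟨?_, ⟨h3.1, h1⟩, h3.2⟩
      intro h
      rw [h] at h2
      exact hne b hb2 h2
    · intro b hb b' hb' h
      have := hP1 _ (hg b hb).2 _ (hg b' hb').2 h
      exact congrArg Prod.snd this
  have heN := (hA e heL).1 heA
  have hmem : e ∈ (N ∩ L) \ M := by
    rw [mem_sdiff, mem_inter]
    exact ⟨⟨heN.1, heL⟩, heN.2⟩
  have h1 := card_erase_add_one hmem
  have h2 := card_sdiff_add_card_inter (M ∩ L) N
  have h3 := card_sdiff_add_card_inter (N ∩ L) M
  have h4 : (M ∩ L) ∩ N = (N ∩ L) ∩ M := by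
    ext x
    simp only [mem_inter]
    tauto
  rw [h4] at h2
  omega

lemma feas_add {W F E : Type*} [DecidableEq E] (wk : E → W) (fm : E → F)
    (lam : W ⊕ F → Finset (Finset E))
    (q : W ⊕ F → Finset E → ℕ) (hlam : LaminarOn wk fm lam) (a : W ⊕ F) (M N : Finset E)
    (hM : FeasFor wk fm lam q a M) (hN : FeasFor wk fm lam q a N) (e : E)
    (h : ∀ L ∈ lam a, e ∈ L → (M ∩ L).card + 1 ≤ (N ∩ L).card) :
    FeasFor wk fm lam q a (insert e M) := by
  rw [feas_iff wk fm lam q hlam] at hM hN ⊢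
  intro L hL S hS
  by_cases he : e ∈ L
  · have h1 := h L hL he
    have h2 := hN L hL (N ∩ L) (fun x => mem_inter)
    have h3 : S ⊆ insert e (M ∩ L) := by
      intro x hx
      rw [hS, mem_insert] at hx
      rw [mem_insert, mem_inter]
      tauto
    have h4 := (card_le_card h3).trans (card_insert_le _ _)
    omega
  · apply hM L hL
    intro x
    rw [hS, mem_insert]
    constructor
    · rintro ⟨rfl | h, h'⟩
      · exact absurd h' he
      · exact ⟨h, h'⟩
    · tauto

lemma feas_swap {W F E : Type*} [DecidableEq E] (wk : E → W) (fm : E → F)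
    (lam : W ⊕ F → Finset (Finset E))
    (q : W ⊕ F → Finset E → ℕ) (hlam : LaminarOn wk fm lam) (a : W ⊕ F) (M N : Finset E)
    (hM : FeasFor wk fm lam q a M) (hN : FeasFor wk fm lam q a N) (e b : E) (hb : b ∈ M)
    (h : ∀ L ∈ lam a, e ∈ L → b ∉ L → (M ∩ L).card + 1 ≤ (N ∩ L).card) :
    FeasFor wk fm lam q a ((insert e M).erase b) := by
  rw [feas_iff wk fm lam q hlam] at hM hN ⊢
  intro L hL S hS
  have h0 := hM L hL (M ∩ L) (fun x => mem_inter)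
  by_cases he : e ∈ L
  · have h2 := hN L hL (N ∩ L) (fun x => mem_inter)
    by_cases hbL : b ∈ L
    · have h3 : S ⊆ insert e ((M ∩ L).erase b) := by
        intro x hx
        rw [hS, mem_erase, mem_insert] at hx
        rw [mem_insert, mem_erase, mem_inter]
        tauto
      have h4 := (card_le_card h3).trans (card_insert_le _ _)
      have h5 := card_erase_add_one (mem_inter.2 ⟨hb, hbL⟩)
      omega
    · have h1 := h L hL he hbL
      have h3 : S ⊆ insert e (M ∩ L) := by
        intro x hx
        rw [hS, mem_erase, mem_insert] at hx
        rw [mem_insert, mem_inter]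
        tauto
      have h4 := (card_le_card h3).trans (card_insert_le _ _)
      omega
  · have h3 : S ⊆ M ∩ L := by
      intro x hx
      rw [hS, mem_erase, mem_insert] at hx
      rw [mem_inter]
      rcases hx with ⟨⟨_, rfl | h⟩, h'⟩
      · exact absurd h' he
      · exact ⟨h, h'⟩
    exact (card_le_card h3).trans h0

/-- Base-orderability of laminar matroids, for a fixed agent. -/
lemma agent_pairing {W F E : Type*} [DecidableEq E] (wk : E → W) (fm : E → F)
    (lam : W ⊕ F → Finset (Finset E))
    (q : W ⊕ F → Finset E → ℕ) (hlam : LaminarOn wk fm lam) (a : W ⊕ F) (M N : Finset E)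
    (hM : FeasFor wk fm lam q a M) (hN : FeasFor wk fm lam q a N) :
    ∃ P : Finset (E × E),
      (∀ p ∈ P, (p.1 ∈ N ∧ p.1 ∉ M ∧ Assoc wk fm a p.1) ∧
        (p.2 ∈ M ∧ p.2 ∉ N ∧ Assoc wk fm a p.2)) ∧
      (∀ p ∈ P, ∀ p' ∈ P, p.1 = p'.1 → p = p') ∧
      (∀ p ∈ P, ∀ p' ∈ P, p.2 = p'.2 → p = p') ∧
      (∀ p ∈ P, FeasFor wk fm lam q a ((insert p.1 M).erase p.2) ∧
        FeasFor wk fm lam q a ((insert p.2 N).erase p.1)) ∧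
      (∀ e ∈ N, e ∉ M → Assoc wk fm a e → (∀ b, (e, b) ∉ P) →
        FeasFor wk fm lam q a (insert e M)) := by
  set A := (N \ M).filter (Assoc wk fm a) with hAdef
  set B := (M \ N).filter (Assoc wk fm a) with hBdef
  have hA : ∀ x, x ∈ A ↔ x ∈ N ∧ x ∉ M ∧ Assoc wk fm a x := by
    intro x; rw [hAdef, mem_filter, mem_sdiff]; tauto
  have hB : ∀ x, x ∈ B ↔ x ∈ M ∧ x ∉ N ∧ Assoc wk fm a x := by
    intro x; rw [hBdef, mem_filter, mem_sdiff]; tauto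
  obtain ⟨P, h1, h2, h3, h4⟩ := exists_pairing A B (lam a) (by
    intro L hL L' hL' x hx hx'
    rcases (hlam a).2 L hL L' hL' with h | h | h
    · exact Or.inl h
    · exact Or.inr h
    · have hm := (Finset.ext_iff.1 h x).1 (by simp only [mem_inter]; exact ⟨hx, hx'⟩)
      exact absurd hm (notMem_empty x))
  have hAL : ∀ L ∈ lam a, ∀ x ∈ L, x ∈ A ↔ x ∈ N ∧ x ∉ M := by
    intro L hL x hx
    have := (hlam a).1 L hL x hx
    rw [hA]; tauto
  have hBL : ∀ L ∈ lam a, ∀ x ∈ L, x ∈ B ↔ x ∈ M ∧ x ∉ N := by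
    intro L hL x hx
    have := (hlam a).1 L hL x hx
    rw [hB]; tauto
  refine ⟨P, fun p hp => ⟨(hA _).1 (h1 p hp).1, (hB _).1 (h1 p hp).2.1⟩, h2, h3, ?_, ?_⟩
  · rintro ⟨e, b⟩ hp
    have he := (hA _).1 (h1 _ hp).1
    have hb := (hB _).1 (h1 _ hp).2.1
    constructor
    · apply feas_swap wk fm lam q hlam a M N hM hN e b hb.1
      intro L hL heL hbL
      apply exchange_aux M N A B L P (fun p hp => ⟨(h1 p hp).1, (h1 p hp).2.1⟩) h2
        (hAL L hL) (hBL L hL) (h4 L hL) e ((hA _).2 he) heL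
      intro b' hb' hp'
      have := h2 _ hp _ hp' rfl
      have : b = b' := congrArg Prod.snd this
      exact hbL (this ▸ hb')
    · apply feas_swap wk fm lam q hlam a N M hN hM b e he.1
      intro L hL hbL heL
      have hsw : ∀ x y, (y, x) ∈ P.image Prod.swap ↔ (x, y) ∈ P := by
        intro x y
        simp
      apply exchange_aux N M B A L (P.image Prod.swap) ?_ ?_
        (hBL L hL) (hAL L hL) ?_ b ((hB _).2 hb) hbL
      · intro e' he' hp'
        rw [hsw] at hp'
        have := h3 _ hp _ hp' rfl
        have : e = e' := congrArg Prod.fst this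
        exact heL (this ▸ he')
      · rintro ⟨y, x⟩ hp
        rw [hsw] at hp
        exact ⟨(h1 _ hp).2.1, (h1 _ hp).1⟩
      · rintro ⟨y, x⟩ hp ⟨y', x'⟩ hp' h
        rw [hsw] at hp hp'
        have := h3 _ hp _ hp' h
        simp only [Prod.mk.injEq] at this ⊢
        tauto
      · rcases h4 L hL with h | h
        · right
          intro x hx hx'
          obtain ⟨y, hy, hy'⟩ := h x hx hx'
          exact ⟨y, hy, (hsw _ _).2 hy'⟩
        · left
          intro x hx hx'
          obtain ⟨y, hy, hy'⟩ := h x hx hx'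
          exact ⟨y, hy, (hsw _ _).2 hy'⟩
  · intro e heN heM hea hne
    apply feas_add wk fm lam q hlam a M N hM hN e
    intro L hL heL
    exact exchange_aux M N A B L P (fun p hp => ⟨(h1 p hp).1, (h1 p hp).2.1⟩) h2
        (hAL L hL) (hBL L hL) (h4 L hL) e ((hA _).2 ⟨heN, heM, hea⟩) heL (fun b _ => hne b)

/-- Transfer of feasibility between `I` and `I*`. -/
lemma feasStar_iff {W F E : Type*} [DecidableEq E] (wk : E → W) (fm : E → F)
    (lam : W ⊕ F → Finset (Finset E))
    (q : W ⊕ F → Finset E → ℕ) (a : W ⊕ F) (S : Finset (E × Fin 3)) (M : Finset E)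
    (hinj : ∀ c ∈ S, ∀ c' ∈ S, c.1 = c'.1 → c = c')
    (hSM : ∀ e, e ∈ M ↔ ∃ t, (e, t) ∈ S) :
    FeasForStar wk fm lam q a S ↔ FeasFor wk fm lam q a M := by
  have hcard : ∀ L, (restrictTo (fun c : E × Fin 3 => wk c.1) (fun c => fm c.1) a S ∩
        (L ×ˢ (Finset.univ : Finset (Fin 3)))).card = (restrictTo wk fm a M ∩ L).card := by
    intro L
    apply Finset.card_bij (fun c _ => c.1)
    · intro c hc
      simp only [restrictTo, mem_inter, mem_filter, mem_product] at hc ⊢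
      refine ⟨⟨(hSM _).2 ⟨c.2, hc.1.1⟩, ?_⟩, hc.2.1⟩
      have := hc.1.2
      cases a <;> exact this
    · intro c hc c' hc' h
      simp only [restrictTo, mem_inter, mem_filter] at hc hc'
      exact hinj c hc.1.1 c' hc'.1.1 h
    · intro e he
      simp only [restrictTo, mem_inter, mem_filter] at he
      obtain ⟨t, ht⟩ := (hSM e).1 he.1.1
      refine ⟨(e, t), ?_, rfl⟩
      simp only [restrictTo, mem_inter, mem_filter, mem_product, mem_univ, and_true]
      refine ⟨⟨ht, ?_⟩, he.2⟩
      have := he.1.2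
      cases a <;> exact this
  constructor
  · intro h L hL
    have h1 := h.2 L hL
    have h2 := hcard L
    refine le_trans (le_of_eq ?_) h1
    convert h2.symm
  · intro h
    constructor
    · intro e _
      rw [card_le_one]
      intro c hc c' hc'
      simp only [restrictTo, mem_inter, mem_filter, mem_product, mem_singleton] at hc hc'
      exact hinj c hc.1.1 c' hc'.1.1 (hc.2.1.trans hc'.2.1.symm)
    · intro L hL
      have h1 := h L hL
      have h2 := hcard L
      refine le_trans (le_of_eq ?_) h1
      convert h2

lemma count_aux {E : Type*} [DecidableEq E] (A B : Finset E) (P Q : Finset (E × E))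
    (hP : ∀ p ∈ P, p.1 ∈ A ∧ p.2 ∈ B) (hQ : ∀ p ∈ Q, p.1 ∈ A ∧ p.2 ∈ B)
    (hP1 : ∀ p ∈ P, ∀ p' ∈ P, p.1 = p'.1 → p = p')
    (hP2 : ∀ p ∈ P, ∀ p' ∈ P, p.2 = p'.2 → p = p')
    (hQ1 : ∀ p ∈ Q, ∀ p' ∈ Q, p.1 = p'.1 → p = p')
    (hQ2 : ∀ p ∈ Q, ∀ p' ∈ Q, p.2 = p'.2 → p = p')
    (hcov : ∀ e ∈ A, (∃ b, (e, b) ∈ P) ∨ ∃ b, (e, b) ∈ Q)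
    (hbad : ∀ e e' b, (e, b) ∈ P → (e', b) ∈ Q → (∀ b', (e, b') ∉ Q) → (∀ b', (e', b') ∉ P) →
      False) :
    2 * A.card ≤ 3 * B.card := by
  -- domains
  have hPd : (P.image Prod.fst).card = P.card := card_image_of_injOn (fun p hp p' hp' => hP1 p hp p' hp')
  have hQd : (Q.image Prod.fst).card = Q.card := card_image_of_injOn (fun p hp p' hp' => hQ1 p hp p' hp')
  have hPB : P.card ≤ B.card := by
    rw [← card_image_of_injOn (f := Prod.snd) (s := P) (fun p hp p' hp' => hP2 p hp p' hp')]
    apply card_le_card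
    intro b hb
    obtain ⟨p, hp, rfl⟩ := mem_image.1 hb
    exact (hP p hp).2
  have hQB : Q.card ≤ B.card := by
    rw [← card_image_of_injOn (f := Prod.snd) (s := Q) (fun p hp p' hp' => hQ2 p hp p' hp')]
    apply card_le_card
    intro b hb
    obtain ⟨p, hp, rfl⟩ := mem_image.1 hb
    exact (hQ p hp).2
  have hA : A.card ≤ (P.image Prod.fst ∪ Q.image Prod.fst).card := by
    apply card_le_card
    intro e he
    rw [mem_union, mem_image, mem_image]
    rcases hcov e he with ⟨b, hb⟩ | ⟨b, hb⟩
    · exact Or.inl ⟨_, hb, rfl⟩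
    · exact Or.inr ⟨_, hb, rfl⟩
  -- the pairs whose first component is matched only once
  let P' := P.filter (fun p => ∀ b', (p.1, b') ∉ Q)
  let Q' := Q.filter (fun p => ∀ b', (p.1, b') ∉ P)
  have hP' : (P'.image Prod.snd).card = P'.card :=
    card_image_of_injOn (fun p hp p' hp' => hP2 p (mem_filter.1 hp).1 p' (mem_filter.1 hp').1)
  have hQ' : (Q'.image Prod.snd).card = Q'.card :=
    card_image_of_injOn (fun p hp p' hp' => hQ2 p (mem_filter.1 hp).1 p' (mem_filter.1 hp').1)
  have hdisj : Disjoint (P'.image Prod.snd) (Q'.image Prod.snd) := by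
    rw [disjoint_left]
    intro b hb hb'
    obtain ⟨⟨e, b1⟩, hp, rfl⟩ := mem_image.1 hb
    obtain ⟨⟨e', b2⟩, hp', hh⟩ := mem_image.1 hb'
    simp only at hh
    subst hh
    exact hbad e e' b2 (mem_filter.1 hp).1 (mem_filter.1 hp').1 (mem_filter.1 hp).2
      (mem_filter.1 hp').2
  have hle : P'.card + Q'.card ≤ B.card := by
    rw [← hP', ← hQ', ← card_union_of_disjoint hdisj]
    apply card_le_card
    intro b hb
    rcases mem_union.1 hb with hb | hb <;> obtain ⟨p, hp, rfl⟩ := mem_image.1 hb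
    · exact (hP p (mem_filter.1 hp).1).2
    · exact (hQ p (mem_filter.1 hp).1).2
  have hPs : (P.image Prod.fst \ Q.image Prod.fst).card ≤ P'.card := by
    refine le_trans (card_le_card ?_) (card_image_le (s := P') (f := Prod.fst))
    intro e he
    rw [mem_sdiff, mem_image] at he
    obtain ⟨⟨p, hp, rfl⟩, hn⟩ := he
    exact mem_image.2 ⟨p, mem_filter.2 ⟨hp, fun b' hb' => hn (mem_image.2 ⟨_, hb', rfl⟩)⟩, rfl⟩
  have hQs : (Q.image Prod.fst \ P.image Prod.fst).card ≤ Q'.card := by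
    refine le_trans (card_le_card ?_) (card_image_le (s := Q') (f := Prod.fst))
    intro e he
    rw [mem_sdiff, mem_image] at he
    obtain ⟨⟨p, hp, rfl⟩, hn⟩ := he
    exact mem_image.2 ⟨p, mem_filter.2 ⟨hp, fun b' hb' => hn (mem_image.2 ⟨_, hb', rfl⟩)⟩, rfl⟩
  have e1 := card_sdiff_add_card_inter (P.image Prod.fst) (Q.image Prod.fst)
  have e2 := card_sdiff_add_card_inter (Q.image Prod.fst) (P.image Prod.fst)
  rw [inter_comm] at e2
  have e3 := card_union_add_card_inter (P.image Prod.fst) (Q.image Prod.fst)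
  omega

lemma side_pairing {W F E : Type*} [Fintype E] [DecidableEq E] (wk : E → W) (fm : E → F)
    (lam : W ⊕ F → Finset (Finset E))
    (q : W ⊕ F → Finset E → ℕ) (hlam : LaminarOn wk fm lam) (M N : Finset E)
    (hM : ∀ a, FeasFor wk fm lam q a M) (hN : ∀ a, FeasFor wk fm lam q a N)
    (g : E → W ⊕ F) (hg : ∀ e e', Assoc wk fm (g e) e' ↔ g e' = g e) :
    ∃ P : Finset (E × E),
      (∀ p ∈ P, (p.1 ∈ N ∧ p.1 ∉ M) ∧ (p.2 ∈ M ∧ p.2 ∉ N) ∧ g p.2 = g p.1) ∧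
      (∀ p ∈ P, ∀ p' ∈ P, p.1 = p'.1 → p = p') ∧
      (∀ p ∈ P, ∀ p' ∈ P, p.2 = p'.2 → p = p') ∧
      (∀ p ∈ P, FeasFor wk fm lam q (g p.1) ((insert p.1 M).erase p.2) ∧
        FeasFor wk fm lam q (g p.1) ((insert p.2 N).erase p.1)) ∧
      (∀ e ∈ N, e ∉ M → (∀ b, (e, b) ∉ P) → FeasFor wk fm lam q (g e) (insert e M)) := by
  choose P h1 h2 h3 h4 h5 using fun a => agent_pairing wk fm lam q hlam a M N (hM a) (hN a)
  have hmem : ∀ p, p ∈ (univ : Finset (E × E)).filter (fun p => p ∈ P (g p.1)) ↔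
      p ∈ P (g p.1) := by
    intro p; simp
  refine ⟨(univ : Finset (E × E)).filter (fun p => p ∈ P (g p.1)), ?_, ?_, ?_, ?_, ?_⟩
  · intro p hp
    rw [hmem] at hp
    obtain ⟨ha, hb⟩ := h1 _ p hp
    exact ⟨⟨ha.1, ha.2.1⟩, ⟨hb.1, hb.2.1⟩, (hg _ _).1 hb.2.2⟩
  · intro p hp p' hp' h
    rw [hmem] at hp hp'
    rw [← h] at hp'
    exact h2 _ p hp p' hp' h
  · intro p hp p' hp' h
    rw [hmem] at hp hp'
    have e1 := (hg _ _).1 (h1 _ p hp).2.2.2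
    have e2 := (hg _ _).1 (h1 _ p' hp').2.2.2
    rw [← h, e1] at e2
    rw [← e2] at hp'
    exact h3 _ p hp p' hp' h
  · intro p hp
    rw [hmem] at hp
    exact h4 _ p hp
  · intro e he he' hne
    apply h5 _ e he he' ((hg _ _).2 rfl)
    intro b hb
    exact hne b ((hmem (e, b)).2 hb)

lemma star_free_add {W F E : Type*} [LinearOrder E] (wk : E → W) (fm : E → F)
    (lam : W ⊕ F → Finset (Finset E)) (q : W ⊕ F → Finset E → ℕ)
    (pref : W ⊕ F → E → E → Prop) (S : Finset (E × Fin 3)) (M : Finset E)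
    (hinj : ∀ c ∈ S, ∀ c' ∈ S, c.1 = c'.1 → c = c')
    (hSM : ∀ e, e ∈ M ↔ ∃ t, (e, t) ∈ S) (a : W ⊕ F) (e : E) (he : e ∉ M) (t : Fin 3)
    (h : FeasFor wk fm lam q a (insert e M)) :
    FreeFor (fun c : E × Fin 3 => wk c.1) (fun c => fm c.1) (FeasForStar wk fm lam q)
      (PrefStar pref) a S (e, t) := by
  left
  rw [feasStar_iff wk fm lam q a _ (insert e M)]
  · exact h
  · have hn : ∀ c ∈ S, c.1 ≠ e := by
      rintro ⟨c1, c2⟩ hc rfl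
      exact he ((hSM _).2 ⟨_, hc⟩)
    intro c hc c' hc' hh
    rcases mem_insert.1 hc with rfl | hc <;> rcases mem_insert.1 hc' with rfl | hc'
    · rfl
    · exact absurd hh.symm (hn _ hc')
    · exact absurd hh (hn _ hc)
    · exact hinj c hc c' hc' hh
  · intro x
    simp only [mem_insert, Prod.mk.injEq, hSM]
    constructor
    · rintro (rfl | ⟨s, hs⟩)
      · exact ⟨t, Or.inl ⟨rfl, rfl⟩⟩
      · exact ⟨s, Or.inr hs⟩
    · rintro ⟨s, ⟨rfl, rfl⟩ | hs⟩
      · exact Or.inl rfl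
      · exact Or.inr ⟨s, hs⟩

lemma star_free_swap {W F E : Type*} [LinearOrder E] (wk : E → W) (fm : E → F)
    (lam : W ⊕ F → Finset (Finset E)) (q : W ⊕ F → Finset E → ℕ)
    (pref : W ⊕ F → E → E → Prop) (S : Finset (E × Fin 3)) (M : Finset E)
    (hinj : ∀ c ∈ S, ∀ c' ∈ S, c.1 = c'.1 → c = c')
    (hSM : ∀ e, e ∈ M ↔ ∃ t, (e, t) ∈ S) (a : W ⊕ F) (e : E) (he : e ∉ M) (t : Fin 3)
    (m : E) (s : Fin 3) (hm : (m, s) ∈ S) (ham : Assoc wk fm a m)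
    (hp : PrefStar pref a (e, t) (m, s))
    (h : FeasFor wk fm lam q a ((insert e M).erase m)) :
    FreeFor (fun c : E × Fin 3 => wk c.1) (fun c => fm c.1) (FeasForStar wk fm lam q)
      (PrefStar pref) a S (e, t) := by
  right
  refine ⟨(m, s), ?_, hp, ?_⟩
  · rw [restrictTo, mem_filter]
    refine ⟨hm, ?_⟩
    cases a <;> exact ham
  have hn : ∀ c ∈ S, c.1 ≠ e := by
    rintro ⟨c1, c2⟩ hc rfl
    exact he ((hSM _).2 ⟨_, hc⟩)
  rw [feasStar_iff wk fm lam q a _ ((insert e M).erase m)]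
  · exact h
  · intro c hc c' hc' hh
    replace hc := mem_of_mem_erase hc
    replace hc' := mem_of_mem_erase hc'
    rcases mem_insert.1 hc with rfl | hc <;> rcases mem_insert.1 hc' with rfl | hc'
    · rfl
    · exact absurd hh.symm (hn _ hc')
    · exact absurd hh (hn _ hc)
    · exact hinj c hc c' hc' hh
  · intro x
    simp only [mem_erase, mem_insert, Prod.mk.injEq, hSM, ne_eq]
    constructor
    · rintro ⟨hxm, rfl | ⟨s', hs⟩⟩
      · exact ⟨t, fun h => hxm h.1, Or.inl ⟨rfl, rfl⟩⟩
      · exact ⟨s', fun h => hxm h.1, Or.inr hs⟩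
    · rintro ⟨s', hne, ⟨rfl, rfl⟩ | hs⟩
      · exact ⟨fun h => hn _ hm h.symm, Or.inl rfl⟩
      · refine ⟨?_, Or.inr ⟨s', hs⟩⟩
        rintro rfl
        have := hinj _ hs _ hm rfl
        exact hne ⟨rfl, congrArg Prod.snd this⟩

lemma main_bound {W F E : Type*} [Fintype E] [LinearOrder E]
    (wk : E → W) (fm : E → F)
    (lam : W ⊕ F → Finset (Finset E)) (q : W ⊕ F → Finset E → ℕ)
    (pref : W ⊕ F → E → E → Prop)
    (hlam : LaminarOn wk fm lam)
    (htotal : ∀ (a : W ⊕ F) (e e' : E), pref a e e' ∨ pref a e' e)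
    (S : Finset (E × Fin 3))
    (hS : StableStar wk fm lam q pref S) (N : Finset E) (hN : StableI wk fm lam q pref N) :
    2 * N.card ≤ 3 * (projAux S).card := by
  set M := projAux S with hMdef
  have hSM : ∀ e, e ∈ M ↔ ∃ t, (e, t) ∈ S := by
    intro e
    rw [hMdef, projAux, mem_image]
    constructor
    · rintro ⟨⟨e', t⟩, h, rfl⟩
      exact ⟨t, h⟩
    · rintro ⟨t, h⟩
      exact ⟨_, h, rfl⟩
  have hinj : ∀ c ∈ S, ∀ c' ∈ S, c.1 = c'.1 → c = c' := by
    intro c hc c' hc' h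
    have h1 := (hS.1 (Sum.inl (wk c.1))).1 c.1 rfl
    rw [card_le_one] at h1
    apply h1
    · simp only [restrictTo, mem_inter, mem_filter, mem_product, mem_singleton, mem_univ, and_true]
      exact ⟨hc, rfl⟩
    · simp only [restrictTo, mem_inter, mem_filter, mem_product, mem_singleton, mem_univ, and_true]
      exact ⟨⟨hc', congrArg wk h.symm⟩, h.symm⟩
  have hM : ∀ a, FeasFor wk fm lam q a M := fun a =>
    (feasStar_iff wk fm lam q a S M hinj hSM).1 (hS.1 a)
  obtain ⟨P, p1, p2, p3, p4, p5⟩ := side_pairing wk fm lam q hlam M N hM hN.1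
    (fun e => Sum.inl (wk e)) (fun e e' => by simp [Assoc])
  obtain ⟨Q, q1, q2, q3, q4, q5⟩ := side_pairing wk fm lam q hlam M N hM hN.1
    (fun e => Sum.inr (fm e)) (fun e e' => by simp [Assoc])
  have hnotS : ∀ e, e ∉ M → ∀ t, (e, t) ∉ S := fun e he t h => he ((hSM e).2 ⟨t, h⟩)
  have hcount : 2 * (N \ M).card ≤ 3 * (M \ N).card := by
    apply count_aux (N \ M) (M \ N) P Q
    · intro p hp
      rw [mem_sdiff, mem_sdiff]
      exact ⟨(p1 p hp).1, (p1 p hp).2.1⟩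
    · intro p hp
      rw [mem_sdiff, mem_sdiff]
      exact ⟨(q1 p hp).1, (q1 p hp).2.1⟩
    · exact p2
    · exact p3
    · exact q2
    · exact q3
    · intro e he
      rw [mem_sdiff] at he
      by_contra hcon
      push Not at hcon
      exact hS.2 (e, 0) (hnotS e he.2 0)
        ⟨star_free_add wk fm lam q pref S M hinj hSM _ e he.2 0 (p5 e he.1 he.2 hcon.1),
          star_free_add wk fm lam q pref S M hinj hSM _ e he.2 0 (q5 e he.1 he.2 hcon.2)⟩
    · intro e2 e1 m hp hq he2 he1
      obtain ⟨⟨h2N, h2M⟩, ⟨hmM, hmN⟩, hw⟩ := p1 _ hp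
      obtain ⟨⟨h1N, h1M⟩, _, hf⟩ := q1 _ hq
      simp only at h2N h2M hmM hmN hw h1N h1M hf
      obtain ⟨s, hs⟩ := (hSM m).1 hmM
      have hw' : wk m = wk e2 := Sum.inl.inj hw
      have hf' : fm m = fm e1 := Sum.inr.inj hf
      -- worker side: `e2` is free for its firm in every copy
      have hW : ∀ t, ¬ PrefStar pref (Sum.inl (wk e2)) (e2, t) (m, s) := by
        intro t ht
        exact hS.2 (e2, t) (hnotS e2 h2M t)
          ⟨star_free_swap wk fm lam q pref S M hinj hSM _ e2 h2M t m s hs hw' ht (p4 _ hp).1,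
            star_free_add wk fm lam q pref S M hinj hSM _ e2 h2M t (q5 e2 h2N h2M he2)⟩
      have hF : ∀ t, ¬ PrefStar pref (Sum.inr (fm e1)) (e1, t) (m, s) := by
        intro t ht
        exact hS.2 (e1, t) (hnotS e1 h1M t)
          ⟨star_free_add wk fm lam q pref S M hinj hSM _ e1 h1M t (p5 e1 h1N h1M he1),
            star_free_swap wk fm lam q pref S M hinj hSM _ e1 h1M t m s hs hf' ht (q4 _ hq).1⟩
      have hW0 := hW 0
      have hF2 := hF 2
      have hs1 : s = 1 := by
        fin_cases s
        · exact absurd (Or.inl (by simp [copySec])) hF2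
        · rfl
        · exact absurd (Or.inl (by simp [copySec])) hW0
      subst hs1
      have hpw : ¬ pref (Sum.inl (wk e2)) e2 m := by
        intro h
        apply hW0
        right
        refine ⟨by simp [copySec], ?_⟩
        by_cases h' : pref (Sum.inl (wk e2)) m e2
        · exact Or.inr ⟨⟨h, h'⟩, Or.inl (by simp [copySlot])⟩
        · exact Or.inl ⟨h, h'⟩
      have hpf : ¬ pref (Sum.inr (fm e1)) e1 m := by
        intro h
        apply hF2
        right
        refine ⟨by simp [copySec], ?_⟩
        by_cases h' : pref (Sum.inr (fm e1)) m e1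
        · exact Or.inr ⟨⟨h, h'⟩, Or.inl (by simp [copySlot])⟩
        · exact Or.inl ⟨h, h'⟩
      have hpw' := (htotal (Sum.inl (wk e2)) e2 m).resolve_left hpw
      have hpf' := (htotal (Sum.inr (fm e1)) e1 m).resolve_left hpf
      refine hN.2 m hmN ⟨Or.inr ⟨e2, ?_, ?_, ?_⟩, Or.inr ⟨e1, ?_, ?_, ?_⟩⟩
      · rw [restrictTo, mem_filter]
        exact ⟨h2N, hw'.symm⟩
      · rw [hw']
        exact ⟨hpw', hpw⟩
      · rw [hw']
        exact (p4 _ hp).2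
      · rw [restrictTo, mem_filter]
        exact ⟨h1N, hf'.symm⟩
      · rw [hf']
        exact ⟨hpf', hpf⟩
      · rw [hf']
        exact (q4 _ hq).2
  have e1 := card_sdiff_add_card_inter N M
  have e2 := card_sdiff_add_card_inter M N
  rw [inter_comm] at e2
  omega

/-- **Approximation ratio of the projection (Lemma 5.4).** For any SMTI-LC instance `I`
(laminar constraints, total preorder preferences) and any stable matching `M*` of its
auxiliary instance `I*`, the projection `M = π M*` satisfies `|M| ≥ (2/3)|N|` for every
stable matching `N` of `I`; in particular `|M| ≥ (2/3)|M_OPT|` for any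
maximum-cardinality stable matching `M_OPT` of `I`. -/
theorem aux_projection_approx {W F E : Type*} [Fintype E] [LinearOrder E]
    (wk : E → W) (fm : E → F)
    (lam : W ⊕ F → Finset (Finset E)) (q : W ⊕ F → Finset E → ℕ)
    (pref : W ⊕ F → E → E → Prop)
    (hlam : LaminarOn wk fm lam)
    (htrans : ∀ a : W ⊕ F, Transitive (pref a))
    (htotal : ∀ (a : W ⊕ F) (e e' : E), pref a e e' ∨ pref a e' e)
    (Mstar : Finset (E × Fin 3))
    (hMstar : StableStar wk fm lam q pref Mstar) :
    (∀ N : Finset E, StableI wk fm lam q pref N →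
        (2 / 3 : ℚ) * N.card ≤ (projAux Mstar).card) ∧
      (∀ MOPT : Finset E, StableI wk fm lam q pref MOPT →
        (∀ N : Finset E, StableI wk fm lam q pref N → N.card ≤ MOPT.card) →
        (2 / 3 : ℚ) * MOPT.card ≤ (projAux Mstar).card) := by
  have key : ∀ N : Finset E, StableI wk fm lam q pref N →
      (2 / 3 : ℚ) * N.card ≤ (projAux Mstar).card := by
    intro N hN
    have h := main_bound wk fm lam q pref hlam htotal Mstar hMstar N hN
    have h' : (2 : ℚ) * N.card ≤ 3 * (projAux Mstar).card := by exact_mod_cast h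
    linarith
  exact ⟨key, fun MOPT hM _ => key MOPT hM⟩
end
end

section
/- Let I be an SMTI-LC instance and let I' be the instance obtained from I by replacing each agent's total preorder ⪰_a with an arbitrary strict linear order ≻'_a that refines it (i.e., e ≻_a e' implies e ≻'_a e'). Then any stable matching M of I' is also a stable matching of I and satisfies |M| ≥ (1/2)|M_OPT|, where M_OPT is a maximum-cardinality stable matching of I. -/
open Finset
open scoped Classical

noncomputable section

variable {W F E : Type*}

/-- Counting along a laminar family. -/
lemma laminar_card_le {E : Type*} (X M : Finset E) (T : Finset (Finset E))
    (hT : ∀ L ∈ T, ∀ L' ∈ T, L ⊆ L' ∨ L' ⊆ L ∨ Disjoint L L')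
    (hcard : ∀ L ∈ T, (X ∩ L).card ≤ (M ∩ L).card)
    (hcov : ∀ e ∈ X, e ∉ M → ∃ L ∈ T, e ∈ L) : X.card ≤ M.card := by
  set T' := T.filter (fun L => ∀ L' ∈ T, L ⊆ L' → L' = L) with hT'
  have hdis : ∀ L ∈ T', ∀ L' ∈ T', L ≠ L' → Disjoint L L' := by
    intro L hL L' hL' hne
    rw [hT', Finset.mem_filter] at hL hL'
    rcases hT L hL.1 L' hL'.1 with h | h | h
    · exact absurd (hL.2 L' hL'.1 h).symm hne
    · exact absurd (hL'.2 L hL.1 h) hne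
    · exact h
  have hcov' : ∀ e ∈ X, e ∉ M → ∃ L ∈ T', e ∈ L := by
    intro e he heM
    obtain ⟨L, hL, heL⟩ := hcov e he heM
    obtain ⟨L', hLL', hmax⟩ := T.exists_le_maximal hL
    refine ⟨L', ?_, hLL' heL⟩
    rw [hT', Finset.mem_filter]
    exact ⟨hmax.1, fun K hK h => le_antisymm (hmax.2 hK h) h⟩
  have key : ∀ Y : Finset E, Y.card = (∑ L ∈ T', (Y ∩ L).card) + (Y \ T'.biUnion id).card := by
    intro Y
    rw [← Finset.card_biUnion, ← Finset.inter_biUnion]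
    · exact (Finset.card_inter_add_card_sdiff Y (T'.biUnion id)).symm
    · intro L hL L' hL' hne
      exact (hdis L hL L' hL' hne).mono Finset.inter_subset_right Finset.inter_subset_right
  rw [key X, key M]
  refine Nat.add_le_add (Finset.sum_le_sum fun L hL => hcard L (Finset.mem_filter.1 hL).1)
    (Finset.card_le_card ?_)
  intro e he
  rw [Finset.mem_sdiff] at he ⊢
  refine ⟨?_, he.2⟩
  by_contra heM
  obtain ⟨L, hL, heL⟩ := hcov' e he.1 heM
  exact he.2 (Finset.mem_biUnion.2 ⟨L, hL, heL⟩)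

/-- One side of the market: contracts of `N` that are blocked at agent `ag e`. -/
lemma side_card_le {W F E : Type*} [Fintype E] (wk : E → W) (fm : E → F)
    (lam : W ⊕ F → Finset (Finset E)) (q : W ⊕ F → Finset E → ℕ)
    (hlam : LaminarOn wk fm lam) (ag : E → W ⊕ F) (S : Set (W ⊕ F))
    (hS : ∀ e, ag e ∈ S)
    (hag : ∀ a ∈ S, ∀ e, Assoc wk fm a e → ag e = a)
    (M N : Finset E) (hMf : ∀ a, FeasFor wk fm lam q a M)
    (hNf : ∀ a, FeasFor wk fm lam q a N) :
    (N.filter (fun e => e ∈ M ∨ ¬ FeasFor wk fm lam q (ag e) (insert e M))).card ≤ M.card := by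
  have hr : ∀ a, ∀ L ∈ lam a, ∀ Y : Finset E, restrictTo wk fm a Y ∩ L = Y ∩ L := by
    intro a L hL Y
    ext e
    simp only [restrictTo, Finset.mem_inter, Finset.mem_filter]
    exact ⟨fun h => ⟨h.1.1, h.2⟩, fun h => ⟨⟨h.1, (hlam a).1 L hL e h.2⟩, h.2⟩⟩
  refine laminar_card_le _ M
    (Finset.univ.filter (fun L => ∃ a ∈ S, L ∈ lam a ∧ (M ∩ L).card = q a L)) ?_ ?_ ?_
  · intro L hL L' hL'
    obtain ⟨-, a, ha, hLa, -⟩ := Finset.mem_filter.1 hL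
    obtain ⟨-, b, hb, hLb, -⟩ := Finset.mem_filter.1 hL'
    by_cases hab : a = b
    · subst hab
      rcases (hlam a).2 L hLa L' hLb with h | h | h
      · exact Or.inl h
      · exact Or.inr (Or.inl h)
      · exact Or.inr (Or.inr (Finset.disjoint_iff_inter_eq_empty.2 h))
    · refine Or.inr (Or.inr (Finset.disjoint_left.2 fun e h1 h2 => hab ?_))
      rw [← hag a ha e ((hlam a).1 L hLa e h1), hag b hb e ((hlam b).1 L' hLb e h2)]
  · intro L hL
    obtain ⟨-, a, ha, hLa, hq⟩ := Finset.mem_filter.1 hL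
    rw [hq]
    refine le_trans (Finset.card_le_card ?_) (hr a L hLa N ▸ hNf a L hLa)
    exact Finset.inter_subset_inter_right (Finset.filter_subset _ _)
  · intro e he heM
    have h := (Finset.mem_filter.1 he).2.resolve_left heM
    unfold FeasFor at h
    push Not at h
    obtain ⟨L, hL, hlt⟩ := h
    rw [hr _ L hL] at hlt
    have hMq := hMf (ag e) L hL
    rw [hr _ L hL] at hMq
    have heL : e ∈ L := by
      by_contra heL
      rw [Finset.insert_inter_of_notMem heL] at hlt
      omega
    rw [Finset.insert_inter_of_mem heL] at hlt
    have := Finset.card_insert_le e (M ∩ L)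
    exact ⟨L, Finset.mem_filter.2 ⟨Finset.mem_univ _, ag e, hS e, hL, by omega⟩, heL⟩

/-- **2-approximation by arbitrary tie-breaking (Proposition A.1).** Let `I` be an
SMTI-LC instance with total preorder preferences `⪰_a`, and let `I'` be obtained from
`I` by replacing each `⪰_a` with a strict linear order `≻'_a = pref' a` refining it
(i.e. `e ≻_a e'` implies `e ≻'_a e'`). Then any stable matching `M` of `I'` is a stable
matching of `I` and satisfies `|M| ≥ (1/2)|M_OPT|`, where `M_OPT` is a
maximum-cardinality stable matching of `I`. -/
theorem tiebreak_stable_half_approx {W F E : Type*} [Fintype E] [DecidableEq E]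
    (wk : E → W) (fm : E → F)
    (lam : W ⊕ F → Finset (Finset E)) (q : W ⊕ F → Finset E → ℕ)
    (pref : W ⊕ F → E → E → Prop)
    (hlam : LaminarOn wk fm lam)
    (htrans : ∀ a : W ⊕ F, Transitive (pref a))
    (htotal : ∀ (a : W ⊕ F) (e e' : E), pref a e e' ∨ pref a e' e)
    (pref' : W ⊕ F → E → E → Prop)
    (hirr' : ∀ (a : W ⊕ F) (e : E), ¬ pref' a e e)
    (htrans' : ∀ a : W ⊕ F, Transitive (pref' a))
    (htri' : ∀ (a : W ⊕ F) (e e' : E), e = e' ∨ pref' a e e' ∨ pref' a e' e)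
    (hrefine : ∀ (a : W ⊕ F) (e e' : E), SPref pref a e e' → pref' a e e')
    (M : Finset E)
    (hM : IsStable wk fm (FeasFor wk fm lam q) pref' M)
    (MOPT : Finset E)
    (hopt : StableI wk fm lam q pref MOPT)
    (hmax : ∀ N : Finset E, StableI wk fm lam q pref N → N.card ≤ MOPT.card) :
    StableI wk fm lam q pref M ∧ (1 / 2 : ℚ) * MOPT.card ≤ M.card := by
  obtain rfl : ‹DecidableEq E› = fun a b => Classical.propDecidable (a = b) :=
    Subsingleton.elim _ _
  have hfree : ∀ a e, FreeFor wk fm (FeasFor wk fm lam q) (SPref pref) a M e →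
      FreeFor wk fm (FeasFor wk fm lam q) pref' a M e := by
    rintro a e (h | ⟨e', he', hp, h⟩)
    · exact Or.inl h
    · exact Or.inr ⟨e', he', hrefine a e e' hp, h⟩
  refine ⟨⟨hM.1, fun e he h => hM.2 e he ⟨hfree _ _ h.1, hfree _ _ h.2⟩⟩, ?_⟩
  have h1 := side_card_le wk fm lam q hlam (fun e => Sum.inl (wk e)) (Set.range Sum.inl)
    (fun e => ⟨_, rfl⟩) (by
      rintro _ ⟨w, rfl⟩ e h
      exact congrArg Sum.inl h) M MOPT hM.1 hopt.1
  have h2 := side_card_le wk fm lam q hlam (fun e => Sum.inr (fm e)) (Set.range Sum.inr)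
    (fun e => ⟨_, rfl⟩) (by
      rintro _ ⟨w, rfl⟩ e h
      exact congrArg Sum.inr h) M MOPT hM.1 hopt.1
  have h3 : MOPT.card ≤ M.card + M.card := by
    refine le_trans (le_trans (Finset.card_le_card ?_) (Finset.card_union_le _ _))
      (Nat.add_le_add h1 h2)
    intro e he
    rw [Finset.mem_union, Finset.mem_filter, Finset.mem_filter]
    by_contra hcon
    push Not at hcon
    obtain ⟨heM, hw⟩ := hcon.1 he
    exact hM.2 e heM ⟨Or.inl hw, Or.inl (hcon.2 he).2⟩
  have h4 : (MOPT.card : ℚ) ≤ M.card + M.card := by exact_mod_cast h3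
  linarith
end
end
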